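/- arXiv:1305.4616 — 2 statements merged into one kernel-verified Lean document; each statement's English description precedes it below -/
import Mathlib

section
/- Let 1<p<∞ and 0<s<1 be such that 0<sp≤1. Then there exists a bounded domain (open and connected set) G′ ⊂ ℝ² with a locally (s,p)-uniformly fat boundary, such that G′ does not admit the (s,p)-Hardy inequality. -/
open MeasureTheory Metric Set
open scoped ENNReal NNReal Topology

noncomputable section

/-- Euclidean space `ℝⁿ`. -/
abbrev Euc (n : ℕ) := EuclideanSpace ℝ (Fin n)

/-- The `λ`-Hausdorff content of a set `E ⊆ ℝⁿ`:
`H^λ_∞(E) = inf { Σ_i r_i^λ : E ⊆ ⋃_i B(x_i, r_i), r_i > 0 }`. -/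
def hContent (n : ℕ) (lam : ℝ) (E : Set (Euc n)) : ℝ≥0∞ :=
  ⨅ (c : ℕ → Euc n × ℝ) (_ : ∀ i, 0 < (c i).2)
    (_ : E ⊆ ⋃ i, Metric.ball (c i).1 (c i).2),
    ∑' i, ENNReal.ofReal ((c i).2 ^ lam)

/-- The Riesz `(s,p)`-capacity of a set `E ⊆ ℝⁿ`:
`R_{s,p}(E) = inf { ‖f‖_p^p : f ≥ 0, I_s f ≥ 1 on E }`, where
`I_s f (x) = ∫ f(y) |x-y|^{s-n} dy`. -/
def rieszCap (n : ℕ) (s p : ℝ) (E : Set (Euc n)) : ℝ≥0∞ :=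
  ⨅ (f : Euc n → ℝ) (_ : Measurable f) (_ : ∀ x, 0 ≤ f x)
    (_ : ∀ x ∈ E, 1 ≤ ∫⁻ y, ENNReal.ofReal (f y) * ENNReal.ofReal (dist x y ^ (s - (n : ℝ)))),
    ∫⁻ x, ENNReal.ofReal (f x ^ p)

/-- A set `E ⊆ ℝⁿ` is `(s,p)`-uniformly fat:
`R_{s,p}(B(x,r) ∩ E) ≥ σ r^{n-sp}` for all `x ∈ E`, `r > 0`. -/
def UniformlyFat (n : ℕ) (s p : ℝ) (E : Set (Euc n)) : Prop :=
  ∃ σ : ℝ, 0 < σ ∧ ∀ x ∈ E, ∀ r : ℝ, 0 < r →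
    ENNReal.ofReal (σ * r ^ ((n : ℝ) - s * p)) ≤ rieszCap n s p (Metric.ball x r ∩ E)

/-- A set `E ⊆ ℝⁿ` is locally `(s,p)`-uniformly fat:
`R_{s,p}(B(x,r) ∩ E) ≥ σ r^{n-sp}` for all `x ∈ E`, `0 < r < r₀`. -/
def LocallyUniformlyFat (n : ℕ) (s p : ℝ) (E : Set (Euc n)) : Prop :=
  ∃ σ r₀ : ℝ, 0 < σ ∧ 0 < r₀ ∧ ∀ x ∈ E, ∀ r : ℝ, 0 < r → r < r₀ →
    ENNReal.ofReal (σ * r ^ ((n : ℝ) - s * p)) ≤ rieszCap n s p (Metric.ball x r ∩ E)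

/-- An open set `G ⊆ ℝⁿ` admits the `(s,p)`-Hardy inequality:
`∫_G |u|^p dist(x,∂G)^{-sp} dx ≤ c ∫_G ∫_G |u(x)-u(y)|^p |x-y|^{-(n+sp)} dy dx`
for every `u ∈ C_c^∞(G)`. -/
def AdmitsHardy (n : ℕ) (s p : ℝ) (G : Set (Euc n)) : Prop :=
  ∃ c : ℝ, 0 < c ∧ ∀ u : Euc n → ℝ,
    ContDiff ℝ (⊤ : ℕ∞) u → HasCompactSupport u → tsupport u ⊆ G →
    (∫⁻ x in G, ENNReal.ofReal (|u x| ^ p / Metric.infDist x (frontier G) ^ (s * p))) ≤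
      ENNReal.ofReal c *
        ∫⁻ x in G, ∫⁻ y in G, ENNReal.ofReal (|u x - u y| ^ p / dist x y ^ ((n : ℝ) + s * p))

/-- `U` is a `c`-John domain with center point `x₀`: every `x ∈ U` is joined to `x₀`
by an arc-length-parameterized (here: 1-Lipschitz) curve `γ : [0,ℓ] → U` with
`dist(γ(t), ∂U) ≥ t/c`. -/
def IsJohnDomain (n : ℕ) (c : ℝ) (U : Set (Euc n)) (x₀ : Euc n) : Prop :=
  IsOpen U ∧ IsConnected U ∧ x₀ ∈ U ∧
  ∀ x ∈ U, ∃ ℓ : ℝ, 0 ≤ ℓ ∧ ∃ γ : ℝ → Euc n,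
    LipschitzOnWith 1 γ (Set.Icc 0 ℓ) ∧ γ 0 = x ∧ γ ℓ = x₀ ∧
    ∀ t ∈ Set.Icc 0 ℓ, γ t ∈ U ∧ t / c ≤ Metric.infDist (γ t) (frontier U)

/-- `G_{x,c}`: the union of all `c`-John subdomains of `G` with center point `x`. -/
def johnPart (n : ℕ) (c : ℝ) (G : Set (Euc n)) (x : Euc n) : Set (Euc n) :=
  ⋃₀ {U : Set (Euc n) | U ⊆ G ∧ IsJohnDomain n c U x}

/-- The `c`-visual boundary of `G` near `x`: `∂^vis_{x,c} G = ∂G ∩ ∂G_{x,c}`. -/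
def visualBoundary (n : ℕ) (c : ℝ) (G : Set (Euc n)) (x : Euc n) : Set (Euc n) :=
  frontier G ∩ frontier (johnPart n c G x)

/-- `G` is a uniform domain with constant `C`. -/
def IsUniformDomain (n : ℕ) (C : ℝ) (G : Set (Euc n)) : Prop :=
  IsOpen G ∧ IsConnected G ∧
  ∀ x ∈ G, ∀ y ∈ G, ∃ ℓ : ℝ, 0 ≤ ℓ ∧ ℓ ≤ C * dist x y ∧
    ∃ γ : ℝ → Euc n, LipschitzOnWith 1 γ (Set.Icc 0 ℓ) ∧ γ 0 = x ∧ γ ℓ = y ∧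
      ∀ t ∈ Set.Icc 0 ℓ, γ t ∈ G ∧
        min (dist (γ t) x) (dist (γ t) y) / C ≤ Metric.infDist (γ t) (frontier G)

/-- The closed axis-parallel cube with center `z` and side length `ℓ`. -/
def cube (n : ℕ) (z : Euc n) (ℓ : ℝ) : Set (Euc n) := {y | ∀ i, |y i - z i| ≤ ℓ / 2}

/-- Distance between two sets. -/
def setSetDist (n : ℕ) (A B : Set (Euc n)) : ℝ := sInf (Set.image2 dist A B)

/-- `Q = cube z ℓ` is a Whitney cube of the open set `G`:
`Q ⊆ G` and `diam Q ≤ dist(Q, ∂G) ≤ 4 diam Q`. -/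
def IsWhitneyCube (n : ℕ) (G : Set (Euc n)) (z : Euc n) (ℓ : ℝ) : Prop :=
  0 < ℓ ∧ cube n z ℓ ⊆ G ∧
    Metric.diam (cube n z ℓ) ≤ setSetDist n (cube n z ℓ) (frontier G) ∧
    setSetDist n (cube n z ℓ) (frontier G) ≤ 4 * Metric.diam (cube n z ℓ)

/-- The `p`-th power of the Gagliardo `(s,p)`-seminorm of `u` on `A`:
`|u|_{W^{s,p}(A)}^p = ∫_A ∫_A |u(x)-u(y)|^p |x-y|^{-(n+sp)} dy dx`. -/
def gagliardoP (n : ℕ) (s p : ℝ) (A : Set (Euc n)) (u : Euc n → ℝ) : ℝ≥0∞ :=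
  ∫⁻ x in A, ∫⁻ y in A, ENNReal.ofReal (|u x - u y| ^ p / dist x y ^ ((n : ℝ) + s * p))

/-- `E` is an Ahlfors `λ`-regular set: `E` is closed and
`C⁻¹ r^λ ≤ H^λ(B(x,r) ∩ E) ≤ C r^λ` for `x ∈ E`, `0 < r < diam E`. -/
def AhlforsRegular (n : ℕ) (lam : ℝ) (E : Set (Euc n)) : Prop :=
  IsClosed E ∧ ∃ C : ℝ, 1 < C ∧ ∀ x ∈ E, ∀ r : ℝ, 0 < r →
    ENNReal.ofReal r < EMetric.diam E →
      ENNReal.ofReal (C⁻¹ * r ^ lam) ≤ μH[lam] (Metric.ball x r ∩ E) ∧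
      μH[lam] (Metric.ball x r ∩ E) ≤ ENNReal.ofReal (C * r ^ lam)

theorem lintegral_comp_add_smul {n : ℕ} (x : Euc n) {r : ℝ} (hr : 0 < r) {f : Euc n → ℝ≥0∞}
    (hf : Measurable f) :
    ENNReal.ofReal (r ^ n) * ∫⁻ y, f (x + r • y) = ∫⁻ y, f y := by
  have h1 : ∫⁻ y, f (x + r • y) = ∫⁻ y, f (x + y) ∂(Measure.map (r • ·) volume) := by
    exact (lintegral_map (f := fun y => f (x + y)) (hf.comp (measurable_const_add x))
      (measurable_const_smul r)).symm
  rw [h1, Measure.map_addHaar_smul _ hr.ne', lintegral_smul_measure, smul_eq_mul, ← mul_assoc,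
    ← ENNReal.ofReal_mul (by positivity), lintegral_add_left_eq_self]
  have : r ^ n * |(r ^ n)⁻¹| = 1 := by
    rw [abs_of_pos (by positivity)]; field_simp
  rw [finrank_euclideanSpace, Fintype.card_fin, this]
  simp

theorem lintegral_ball_norm_rpow_lt_top {a : ℝ} (ha : a < 2) :
    ∫⁻ z in ball (0 : Euc 2) 1, ENNReal.ofReal (‖z‖ ^ (-a)) < ∞ := by
  have h : IntegrableOn (fun z : Euc 2 => ‖z‖ ^ (-a)) (ball 0 1) := by
    refine integrableOn_ball_of_norm_le_rpow (C := 1) (α := a) (by simp) (by simpa using ha) ?_ ?_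
    · refine Filter.Eventually.of_forall fun x => ?_
      rw [one_mul, Real.norm_of_nonneg (by positivity)]
    · exact (measurable_norm.pow_const _).aestronglyMeasurable
  exact h.setLIntegral_lt_top

theorem exists_lintegral_ball_dist_rpow_le {s : ℝ} (hs0 : 0 < s) (hs2 : s < 2) :
    ∃ C : ℝ, 0 < C ∧ ∀ y : Euc 2,
      ∫⁻ x in ball (0 : Euc 2) 1, ENNReal.ofReal (dist x y ^ (s - 2)) ≤
        ENNReal.ofReal (C * (1 + ‖y‖) ^ (s - 2)) := by
  set A := ∫⁻ z in ball (0 : Euc 2) 1, ENNReal.ofReal (‖z‖ ^ (s - 2)) with hA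
  have hAfin : A < ∞ := by
    have := lintegral_ball_norm_rpow_lt_top (a := 2 - s) (by linarith)
    simpa [hA] using this
  set v := volume (ball (0 : Euc 2) 1) with hv
  have hvfin : v < ∞ := measure_ball_lt_top
  have hv0 : 0 < v := measure_ball_pos _ _ one_pos
  set B := (A + v).toReal with hB
  have hBeq : ENNReal.ofReal B = A + v := ENNReal.ofReal_toReal (by finiteness)
  have hB0 : 0 < B := ENNReal.toReal_pos (by positivity) (by finiteness)
  refine ⟨3 ^ (2 - s) * B, by positivity, fun y => ?_⟩
  have hy0 := norm_nonneg y
  rcases le_or_gt ‖y‖ 2 with hy | hy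
  · have h1 : ∫⁻ x in ball (0 : Euc 2) 1, ENNReal.ofReal (dist x y ^ (s - 2)) ≤ A + v := by
      calc ∫⁻ x in ball (0 : Euc 2) 1, ENNReal.ofReal (dist x y ^ (s - 2))
          ≤ ∫⁻ x in ball (0 : Euc 2) 1,
              ((ball (0 : Euc 2) 1).indicator (fun z => ENNReal.ofReal (‖z‖ ^ (s - 2))) (x - y)
                + 1) := by
            refine lintegral_mono fun x => ?_
            by_cases hx : x - y ∈ ball (0 : Euc 2) 1
            · rw [indicator_of_mem hx, dist_eq_norm]; exact le_self_add
            · rw [indicator_of_notMem hx, zero_add, dist_eq_norm, ← ENNReal.ofReal_one]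
              apply ENNReal.ofReal_le_ofReal
              exact Real.rpow_le_one_of_one_le_of_nonpos (by simpa using hx) (by linarith)
        _ = (∫⁻ x in ball (0 : Euc 2) 1,
              (ball (0 : Euc 2) 1).indicator (fun z => ENNReal.ofReal (‖z‖ ^ (s - 2))) (x - y))
              + v := by
            rw [lintegral_add_right _ measurable_const]; simp [hv]
        _ ≤ (∫⁻ x, 
              (ball (0 : Euc 2) 1).indicator (fun z => ENNReal.ofReal (‖z‖ ^ (s - 2))) (x - y))
              + v := by
            gcongr; exact Measure.restrict_le_self
        _ = A + v := by
            rw [lintegral_sub_right_eq_self (μ := (volume : Measure (Euc 2)))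
              (fun z => (ball (0 : Euc 2) 1).indicator (fun z => ENNReal.ofReal (‖z‖ ^ (s - 2))) z),
              lintegral_indicator measurableSet_ball]
    refine h1.trans ?_
    rw [← hBeq]
    apply ENNReal.ofReal_le_ofReal
    have h3 : (3 : ℝ) ^ (s - 2) ≤ (1 + ‖y‖) ^ (s - 2) :=
      Real.rpow_le_rpow_of_nonpos (by positivity) (by linarith) (by linarith)
    have h4 : (3 : ℝ) ^ (2 - s) * 3 ^ (s - 2) = 1 := by
      rw [← Real.rpow_add (by norm_num)]; simp
    calc B = (3 : ℝ) ^ (2 - s) * B * 3 ^ (s - 2) := by linear_combination (-B) * h4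
      _ ≤ _ := by gcongr
  · calc ∫⁻ x in ball (0 : Euc 2) 1, ENNReal.ofReal (dist x y ^ (s - 2))
        ≤ ∫⁻ x in ball (0 : Euc 2) 1, ENNReal.ofReal (3 ^ (2 - s) * (1 + ‖y‖) ^ (s - 2)) := by
          refine setLIntegral_mono measurable_const fun x hx => ?_
          apply ENNReal.ofReal_le_ofReal
          have hx1 : ‖x‖ < 1 := by simpa using hx
          have hd : (1 + ‖y‖) / 3 ≤ dist x y := by
            have := norm_sub_norm_le y x
            rw [dist_eq_norm', ]; linarith
          calc dist x y ^ (s - 2) ≤ ((1 + ‖y‖) / 3) ^ (s - 2) :=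
                Real.rpow_le_rpow_of_nonpos (by positivity) hd (by linarith)
            _ = _ := by
              rw [Real.div_rpow (by positivity) (by norm_num), div_eq_mul_inv,
                ← Real.rpow_neg (by norm_num)]; rw [neg_sub]; ring
      _ = ENNReal.ofReal (3 ^ (2 - s) * (1 + ‖y‖) ^ (s - 2)) * v := by simp [hv]
      _ ≤ ENNReal.ofReal (3 ^ (2 - s) * (1 + ‖y‖) ^ (s - 2)) * ENNReal.ofReal B := by
          gcongr; rw [hBeq]; exact le_add_self
      _ = _ := by
          rw [← ENNReal.ofReal_mul (by positivity)]; congr 1; ring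

theorem exists_le_rieszCap_of_subset_unitBall {s p c : ℝ} (hp1 : 1 < p) (hs0 : 0 < s) (hs2 : s < 2)
    (hsp : s * p < 2) (hc : 0 < c) :
    ∃ σ : ℝ, 0 < σ ∧ ∀ E : Set (Euc 2), MeasurableSet E → E ⊆ ball 0 1 →
      ENNReal.ofReal c ≤ volume E → ENNReal.ofReal σ ≤ rieszCap 2 s p E := by
  obtain ⟨C, hC0, hC⟩ := exists_lintegral_ball_dist_rpow_le hs0 hs2
  have hpq : p.HolderConjugate p.conjExponent := Real.HolderConjugate.conjExponent hp1
  set q := p.conjExponent with hq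
  have hq1 : 1 < q := hpq.symm.lt
  set D := ∫⁻ y : Euc 2, ENNReal.ofReal (C * (1 + ‖y‖) ^ (s - 2)) ^ q with hD
  have hDfin : D < ∞ := by
    have h1 : ∀ y : Euc 2, ENNReal.ofReal (C * (1 + ‖y‖) ^ (s - 2)) ^ q =
        ENNReal.ofReal (C ^ q) * ENNReal.ofReal ((1 + ‖y‖) ^ (-((2 - s) * q))) := by
      intro y
      rw [ENNReal.ofReal_rpow_of_nonneg (by positivity) (by positivity),
        Real.mul_rpow hC0.le (by positivity), ← Real.rpow_mul (by positivity),
        ENNReal.ofReal_mul (by positivity)]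
      congr 3; ring
    simp_rw [hD, h1]
    rw [lintegral_const_mul _ (by fun_prop)]
    refine ENNReal.mul_lt_top (by finiteness) (finite_integral_one_add_norm ?_)
    have hq' : q = p / (p - 1) := rfl
    simp only [finrank_euclideanSpace, Fintype.card_fin, Nat.cast_ofNat]
    rw [hq', ← mul_div_assoc, lt_div_iff₀ (by linarith)]
    nlinarith
  have hσ : 0 < (ENNReal.ofReal c / (D + 1) ^ (1 / q)) ^ p := by
    apply ENNReal.rpow_pos
    · apply ENNReal.div_pos
      · simpa using hc
      · exact ENNReal.rpow_ne_top_of_nonneg (by positivity) (by finiteness)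
    · apply ENNReal.div_ne_top (by finiteness)
      have : (1 : ℝ≥0∞) ≤ (D + 1) ^ (1 / q) := ENNReal.one_le_rpow le_add_self (by positivity)
      positivity
  obtain ⟨σ, hσ0, hσ1⟩ := ENNReal.lt_iff_exists_real_btwn.1 hσ
  refine ⟨σ, by simpa using hσ1.1, fun E hE hEs hcE => hσ1.2.le.trans ?_⟩
  simp only [rieszCap, le_iInf_iff]
  intro f hf hf0 hf1
  have hp0 : 0 < p := by linarith
  have key : ENNReal.ofReal c ≤ (∫⁻ x, ENNReal.ofReal (f x ^ p)) ^ (1 / p) * (D + 1) ^ (1 / q) := by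
    calc ENNReal.ofReal c ≤ ∫⁻ x in E, 1 := by simpa using hcE
      _ ≤ ∫⁻ x in E, ∫⁻ y, ENNReal.ofReal (f y) * ENNReal.ofReal (dist x y ^ (s - 2)) := by
          refine setLIntegral_mono' hE fun x hx => ?_
          simpa using hf1 x hx
      _ = ∫⁻ y, ∫⁻ x in E, ENNReal.ofReal (f y) * ENNReal.ofReal (dist x y ^ (s - 2)) := by
          apply lintegral_lintegral_swap
          have : Measurable (fun z : Euc 2 × Euc 2 =>
            ENNReal.ofReal (f z.2) * ENNReal.ofReal (dist z.1 z.2 ^ (s - 2))) := by fun_prop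
          exact this.aemeasurable
      _ ≤ ∫⁻ y, ENNReal.ofReal (f y) * ENNReal.ofReal (C * (1 + ‖y‖) ^ (s - 2)) := by
          refine lintegral_mono fun y => ?_
          rw [lintegral_const_mul _ (by fun_prop)]
          gcongr
          exact (lintegral_mono_set hEs).trans (hC y)
      _ ≤ (∫⁻ y, ENNReal.ofReal (f y) ^ p) ^ (1 / p) * D ^ (1 / q) := by
          exact ENNReal.lintegral_mul_le_Lp_mul_Lq volume hpq
            (f := fun y => ENNReal.ofReal (f y))
            (g := fun y => ENNReal.ofReal (C * (1 + ‖y‖) ^ (s - 2)))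
            (by fun_prop) (by fun_prop)
      _ ≤ (∫⁻ x, ENNReal.ofReal (f x ^ p)) ^ (1 / p) * (D + 1) ^ (1 / q) := by
          have h1 : ∀ y, ENNReal.ofReal (f y) ^ p = ENNReal.ofReal (f y ^ p) := fun y =>
            ENNReal.ofReal_rpow_of_nonneg (hf0 y) hp0.le
          simp_rw [h1]
          gcongr
          exact le_self_add
  have h2 := ENNReal.div_le_of_le_mul key
  calc _ ≤ ((∫⁻ x, ENNReal.ofReal (f x ^ p)) ^ (1 / p)) ^ p := by gcongr
    _ = _ := by
      rw [← ENNReal.rpow_mul, one_div, inv_mul_cancel₀ hp0.ne', ENNReal.rpow_one]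

theorem exists_le_rieszCap_of_le_volume {s p c : ℝ} (hp1 : 1 < p) (hs0 : 0 < s) (hs2 : s < 2)
    (hsp : s * p < 2) (hc : 0 < c) :
    ∃ σ : ℝ, 0 < σ ∧ ∀ (x : Euc 2) (r : ℝ) (E : Set (Euc 2)), 0 < r → MeasurableSet E →
      E ⊆ ball x r → ENNReal.ofReal (c * r ^ 2) ≤ volume E →
        ENNReal.ofReal (σ * r ^ (2 - s * p)) ≤ rieszCap 2 s p E := by
  obtain ⟨σ, hσ0, hσ⟩ := exists_le_rieszCap_of_subset_unitBall hp1 hs0 hs2 hsp hc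
  refine ⟨σ, hσ0, fun x r E hr hE hEs hcE => ?_⟩
  have hm : Measurable (fun y : Euc 2 => x + r • y) := by fun_prop
  set E' : Set (Euc 2) := (fun y => x + r • y) ⁻¹' E with hE'
  have hvol : ENNReal.ofReal (r ^ 2) * volume E' = volume E := by
    have := lintegral_comp_add_smul (n := 2) x hr (f := E.indicator 1)
      (measurable_one.indicator hE)
    rw [lintegral_indicator_one hE] at this
    rw [← this, ← lintegral_indicator_one (hm hE)]
    rfl
  have h1 : ENNReal.ofReal σ ≤ rieszCap 2 s p E' := by
    apply hσ _ (hm hE)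
    · intro y hy
      have := hEs hy
      rw [mem_ball, dist_eq_norm, add_sub_cancel_left, norm_smul, Real.norm_of_nonneg hr.le] at this
      rw [mem_ball_zero_iff]
      by_contra! h
      nlinarith
    · rw [← hvol, mul_comm c, ENNReal.ofReal_mul (by positivity)] at hcE
      exact (ENNReal.mul_le_mul_iff_right (by positivity) (by finiteness)).1 hcE
  simp only [rieszCap, le_iInf_iff]
  intro f hf hf0 hf1
  have h2 : rieszCap 2 s p E' ≤ ∫⁻ y, ENNReal.ofReal ((r ^ s * f (x + r • y)) ^ p) := by
    simp only [rieszCap]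
    refine iInf₂_le_of_le (fun y => r ^ s * f (x + r • y)) (by fun_prop)
      (iInf₂_le_of_le (fun y => ?_) (fun z hz => ?_) le_rfl)
    · have := hf0 (x + r • y); positivity
    · refine (hf1 _ hz).trans ?_
      rw [← lintegral_comp_add_smul (n := 2) x hr (by fun_prop), ← lintegral_const_mul _ (by fun_prop)]
      refine lintegral_mono fun y => ?_
      have hd : dist (x + r • z) (x + r • y) = r * dist z y := by
        rw [dist_add_left, dist_smul₀, Real.norm_of_nonneg hr.le]
      have hf0' := hf0 (x + r • y)
      rw [hd, ← ENNReal.ofReal_mul hf0', ← ENNReal.ofReal_mul (by positivity),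
        ← ENNReal.ofReal_mul (by positivity)]
      apply ENNReal.ofReal_le_ofReal
      rw [Real.mul_rpow hr.le dist_nonneg]
      have : r ^ 2 * r ^ (s - ((2 : ℕ) : ℝ)) = r ^ s := by
        rw [← Real.rpow_natCast r 2, ← Real.rpow_add hr]; simp
      rw [← this]
      apply le_of_eq; ring
  have h3 : ∫⁻ y, ENNReal.ofReal ((r ^ s * f (x + r • y)) ^ p) =
      ENNReal.ofReal (r ^ (s * p)) * ∫⁻ y, ENNReal.ofReal (f (x + r • y) ^ p) := by
    rw [← lintegral_const_mul _ (by fun_prop)]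
    refine lintegral_congr fun y => ?_
    rw [Real.mul_rpow (by positivity) (hf0 _), ← Real.rpow_mul hr.le,
      ENNReal.ofReal_mul (by positivity)]
  have h4 := lintegral_comp_add_smul (n := 2) x hr (f := fun y => ENNReal.ofReal (f y ^ p))
    (by fun_prop)
  rw [← h4]
  have h5 : σ * r ^ (2 - s * p) = r ^ (2 - s * p) * σ := mul_comm _ _
  rw [h5, ENNReal.ofReal_mul (by positivity)]
  calc _ ≤ ENNReal.ofReal (r ^ (2 - s * p)) * (ENNReal.ofReal (r ^ (s * p)) *
        ∫⁻ y, ENNReal.ofReal (f (x + r • y) ^ p)) := by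
        rw [← h3]; gcongr; exact h1.trans h2
    _ = _ := by
        rw [← mul_assoc, ← ENNReal.ofReal_mul (by positivity), ← Real.rpow_add hr,
          ← Real.rpow_natCast r 2]
        simp

theorem exists_lintegral_min_rpow_div_le {p a : ℝ} (ha0 : 0 < a) (hap : a < p) :
    ∃ C : ℝ, 0 < C ∧ ∀ (ε : ℝ) (x : Euc 2), 0 < ε →
      ∫⁻ y : Euc 2, ENNReal.ofReal (min 1 (dist x y / ε) ^ p / dist x y ^ (2 + a)) ≤
        ENNReal.ofReal (C * ε ^ (-a)) := by
  set A := ∫⁻ y : Euc 2, ENNReal.ofReal (min 1 ‖y‖ ^ p / ‖y‖ ^ (2 + a)) with hA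
  have hAfin : A < ∞ := by
    rw [hA, ← lintegral_add_compl _ (measurableSet_ball (x := (0 : Euc 2)) (ε := 1))]
    refine ENNReal.add_lt_top.2 ⟨?_, ?_⟩
    · refine lt_of_le_of_lt ?_ (lintegral_ball_norm_rpow_lt_top (a := 2 + a - p) (by linarith))
      refine setLIntegral_mono' measurableSet_ball fun y hy => ?_
      apply ENNReal.ofReal_le_ofReal
      have hy1 : ‖y‖ < 1 := by simpa using hy
      rw [min_eq_right hy1.le]
      rcases (norm_nonneg y).eq_or_lt with h0 | h0
      · rw [← h0, Real.zero_rpow (by linarith), zero_div]; positivity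
      · rw [← Real.rpow_sub h0]; apply le_of_eq; congr 1; ring
    · have h1 := finite_integral_one_add_norm (E := Euc 2) (μ := volume) (r := 2 + a)
        (by simpa using ha0)
      calc _ ≤ ∫⁻ y : Euc 2, ENNReal.ofReal (2 ^ (2 + a)) *
              ENNReal.ofReal ((1 + ‖y‖) ^ (-(2 + a))) := by
            refine (setLIntegral_mono' (g := fun y => ENNReal.ofReal (2 ^ (2 + a)) *
              ENNReal.ofReal ((1 + ‖y‖) ^ (-(2 + a)))) measurableSet_ball.compl
              fun y hy => ?_).trans (lintegral_mono' Measure.restrict_le_self le_rfl)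
            have hy1 : 1 ≤ ‖y‖ := by simpa using hy
            rw [← ENNReal.ofReal_mul (by positivity)]
            apply ENNReal.ofReal_le_ofReal
            rw [min_eq_left hy1, Real.one_rpow, Real.rpow_neg (by positivity), ← div_eq_mul_inv,
              ← Real.div_rpow (by positivity) (by positivity), one_div, ← Real.inv_rpow (by positivity)]
            apply Real.rpow_le_rpow (by positivity) _ (by linarith)
            rw [inv_eq_one_div, div_le_div_iff₀ (by positivity) (by positivity)]
            linarith
        _ < ∞ := by
            rw [lintegral_const_mul _ (by fun_prop)]
            exact ENNReal.mul_lt_top (by finiteness) h1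
  refine ⟨A.toReal + 1, by positivity, fun ε x hε => ?_⟩
  have h1 := lintegral_comp_add_smul (n := 2) x hε
    (f := fun y => ENNReal.ofReal (min 1 (dist x y / ε) ^ p / dist x y ^ (2 + a))) (by fun_prop)
  rw [← h1]
  have h2 : ∀ y : Euc 2, ENNReal.ofReal (min 1 (dist x (x + ε • y) / ε) ^ p /
      dist x (x + ε • y) ^ (2 + a)) =
      ENNReal.ofReal (ε ^ (-(2 + a))) * ENNReal.ofReal (min 1 ‖y‖ ^ p / ‖y‖ ^ (2 + a)) := by
    intro y
    have hd : dist x (x + ε • y) = ε * ‖y‖ := by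
      rw [dist_self_add_right, norm_smul, Real.norm_of_nonneg hε.le]
    rw [hd, mul_div_cancel_left₀ _ hε.ne', ← ENNReal.ofReal_mul (by positivity),
      Real.mul_rpow hε.le (norm_nonneg _), Real.rpow_neg hε.le]
    congr 1
    rw [mul_comm (ε ^ (2 + a)), ← div_div, div_eq_mul_inv _ (ε ^ (2 + a)), mul_comm]
  simp_rw [h2]
  rw [lintegral_const_mul _ (by fun_prop), ← hA, ← mul_assoc, ← ENNReal.ofReal_mul (by positivity),
    ← ENNReal.ofReal_toReal hAfin.ne, ← ENNReal.ofReal_mul (by positivity)]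
  apply ENNReal.ofReal_le_ofReal
  have h3 : ε ^ 2 * ε ^ (-(2 + a)) = ε ^ (-a) := by
    rw [← Real.rpow_natCast ε 2, ← Real.rpow_add hε]; congr 1; push_cast; ring
  rw [h3, mul_comm]
  gcongr
  simp

/-- The open `h`-neighbourhood of the arithmetic progression `d ℤ + e`. -/
def comb (d e h : ℝ) : Set ℝ := {x | ∃ m : ℤ, |x - (m * d + e)| < h}

theorem isOpen_comb (d e h : ℝ) : IsOpen (comb d e h) := by
  have : comb d e h = ⋃ m : ℤ, {x | |x - (m * d + e)| < h} := by
    ext x; simp [comb]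
  rw [this]
  exact isOpen_iUnion fun m => isOpen_lt (by fun_prop) (by fun_prop)

theorem volume_Icc_inter_comb_le {α β d e h : ℝ} (hαβ : α ≤ β) (hd : 0 < d) (hh : 0 ≤ h) :
    volume (Icc α β ∩ comb d e h) ≤ ENNReal.ofReal (2 * h * ((β - α + 2 * h) / d + 1)) := by
  set a : ℤ := ⌈(α - h - e) / d⌉ with ha
  set b : ℤ := ⌊(β + h - e) / d⌋ with hb
  have hsub : Icc α β ∩ comb d e h ⊆
      ⋃ m ∈ Finset.Icc a b, Ioo (m * d + e - h) (m * d + e + h) := by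
    rintro x ⟨⟨hx1, hx2⟩, m, hm⟩
    rw [abs_lt] at hm
    simp only [Finset.mem_Icc, mem_iUnion, mem_Ioo, exists_prop]
    refine ⟨m, ⟨?_, ?_⟩, by linarith, by linarith⟩
    · rw [ha, Int.ceil_le, div_le_iff₀ hd]; linarith
    · rw [hb, Int.le_floor, le_div_iff₀ hd]; linarith
  have hcard : ((Finset.Icc a b).card : ℝ) ≤ (β - α + 2 * h) / d + 1 := by
    rw [Int.card_Icc]
    have h1 : (((b + 1 - a).toNat : ℤ) : ℝ) = max ((b : ℝ) + 1 - a) 0 := by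
      rw [Int.toNat_eq_max]; push_cast; rfl
    have h2 : (((b + 1 - a).toNat : ℕ) : ℝ) = max ((b : ℝ) + 1 - a) 0 := by
      rw [← h1]; norm_cast
    rw [h2]
    apply max_le
    · have h3 := Int.floor_le ((β + h - e) / d)
      have h4 := Int.le_ceil ((α - h - e) / d)
      have h5 : (β + h - e) / d - (α - h - e) / d = (β - α + 2 * h) / d := by
        rw [← sub_div]; congr 1; ring
      linarith
    · have : 0 ≤ (β - α + 2 * h) / d := div_nonneg (by linarith) hd.le
      linarith
  calc volume (Icc α β ∩ comb d e h) ≤ _ := measure_mono hsub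
    _ ≤ ∑ m ∈ Finset.Icc a b, volume (Ioo ((m : ℝ) * d + e - h) (m * d + e + h)) :=
        measure_biUnion_finset_le _ _
    _ = (Finset.Icc a b).card * ENNReal.ofReal (2 * h) := by
        simp only [Real.volume_Ioo]
        rw [Finset.sum_congr rfl (g := fun _ => ENNReal.ofReal (2 * h))
          (fun m _ => by congr 1; ring)]
        simp
    _ = ENNReal.ofReal (2 * h * (Finset.Icc a b).card) := by
        rw [ENNReal.ofReal_mul (p := 2 * h) (by positivity), ENNReal.ofReal_natCast, mul_comm]
    _ ≤ _ := by gcongr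

/-- The dyadic scale `2^{-ν k}`. -/
def dyad (ν : ℕ → ℕ) (k : ℕ) : ℝ := (1 / 2) ^ ν k

/-- Union of the level-`k` slits, of half-width `dyad ν (k+1)`, centred in the cells of the grid
of mesh `dyad ν k`. -/
def slit (ν : ℕ → ℕ) (k : ℕ) : Set ℝ := comb (dyad ν k) (dyad ν k / 2) (dyad ν (k + 1))

/-- Points of `[-1,1]` outside all slits of level at least `i`. -/
def slitCompl (ν : ℕ → ℕ) (i : ℕ) : Set ℝ := {x | x ∈ Icc (-1) 1 ∧ ∀ k, i ≤ k → x ∉ slit ν k}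

theorem isOpen_slit (ν : ℕ → ℕ) (k : ℕ) : IsOpen (slit ν k) := isOpen_comb _ _ _

theorem isClosed_slitCompl (ν : ℕ → ℕ) (i : ℕ) : IsClosed (slitCompl ν i) := by
  have : slitCompl ν i = Icc (-1) 1 ∩ ⋂ k, ⋂ (_ : i ≤ k), (slit ν k)ᶜ := by
    ext x; simp [slitCompl]
  rw [this]
  exact isClosed_Icc.inter
    (isClosed_iInter fun k => isClosed_iInter fun _ => (isOpen_slit ν k).isClosed_compl)

theorem dyad_pos (ν : ℕ → ℕ) (k : ℕ) : 0 < dyad ν k := by unfold dyad; positivity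

theorem le_of_growth {ν : ℕ → ℕ} (hν : ∀ k, 2 * ν k + k + 8 ≤ ν (k + 1)) (k : ℕ) : k ≤ ν k := by
  rcases k with _ | k
  · simp
  · have := hν k; omega

theorem dyad_le {ν : ℕ → ℕ} (hν : ∀ k, 2 * ν k + k + 8 ≤ ν (k + 1))
    (k : ℕ) : dyad ν k ≤ (1 / 2) ^ k :=
  pow_le_pow_of_le_one (by norm_num) (by norm_num) (le_of_growth hν k)

theorem monotone_of_growth {ν : ℕ → ℕ} (hν : ∀ k, 2 * ν k + k + 8 ≤ ν (k + 1)) : Monotone ν :=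
  monotone_nat_of_le_succ fun k => by have := hν k; omega

theorem dyad_anti {ν : ℕ → ℕ} (hν : ∀ k, 2 * ν k + k + 8 ≤ ν (k + 1))
    : Antitone (dyad ν) := fun _ _ h =>
  pow_le_pow_of_le_one (by norm_num) (by norm_num) (monotone_of_growth hν h)

theorem dyad_succ_eq {ν : ℕ → ℕ} (hν : ∀ k, 2 * ν k + k + 8 ≤ ν (k + 1)) (k : ℕ) :
    dyad ν (k + 1) = (1 / 2) ^ (ν (k + 1) - ν k) * dyad ν k := by
  have := hν k
  unfold dyad; rw [← pow_add]; congr 1; omega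

/-- The ratio of consecutive scales decays geometrically. -/
theorem ratio_le {ν : ℕ → ℕ} (hν : ∀ k, 2 * ν k + k + 8 ≤ ν (k + 1))
    (j l : ℕ) : (1 / 2 : ℝ) ^ (ν (j + l + 1) - ν (j + l)) ≤
    (1 / 2) ^ (ν (j + 1) - ν j) * (1 / 2) ^ l := by
  rw [← pow_add]
  apply pow_le_pow_of_le_one (by norm_num) (by norm_num)
  induction l with
  | zero => simp
  | succ l ih =>
    have h1 := hν (j + l); have h2 := hν (j + l + 1)
    simp only [← add_assoc]; omega

theorem ratio_le_pow {ν : ℕ → ℕ} (hν : ∀ k, 2 * ν k + k + 8 ≤ ν (k + 1))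
    (k : ℕ) : (1 / 2 : ℝ) ^ (ν (k + 1) - ν k) ≤ (1 / 2) ^ (k + 8) := by
  apply pow_le_pow_of_le_one (by norm_num) (by norm_num)
  have := hν k; omega

theorem dyad_succ_le {ν : ℕ → ℕ} (hν : ∀ k, 2 * ν k + k + 8 ≤ ν (k + 1))
    (k : ℕ) : dyad ν (k + 1) ≤ dyad ν k / 256 := by
  rw [dyad_succ_eq hν]
  have h1 := ratio_le_pow hν k
  have h2 : (1 / 2 : ℝ) ^ (k + 8) ≤ 1 / 256 := by
    rw [pow_add]; have : (1 / 2 : ℝ) ^ k ≤ 1 := pow_le_one₀ (by norm_num) (by norm_num)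
    norm_num at this ⊢; linarith
  have := dyad_pos ν k
  nlinarith

theorem volume_Icc_inter_iUnion_slit_le {ν : ℕ → ℕ} (hν : ∀ k, 2 * ν k + k + 8 ≤ ν (k + 1))
    {α ℓ : ℝ} {j : ℕ} (hj : dyad ν j ≤ 4 * ℓ) :
    volume (Icc α (α + ℓ) ∩ ⋃ k, ⋃ (_ : j ≤ k), slit ν k) ≤
      ENNReal.ofReal (36 * (1 / 2) ^ (ν (j + 1) - ν j) * ℓ) := by
  have hℓ : 0 < ℓ := by have := dyad_pos ν j; linarith
  set δ : ℝ := (1 / 2) ^ (ν (j + 1) - ν j)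
  have hδ : 0 < δ := by positivity
  have h1 : ∀ l, volume (Icc α (α + ℓ) ∩ slit ν (j + l)) ≤
      ENNReal.ofReal (18 * δ * ℓ * (1 / 2) ^ l) := fun l => by
    refine (volume_Icc_inter_comb_le (by linarith) (dyad_pos _ _) (dyad_pos _ _).le).trans ?_
    apply ENNReal.ofReal_le_ofReal
    have e1 := dyad_succ_eq hν (j + l)
    have e2 := dyad_succ_le hν (j + l)
    have e3 := ratio_le hν j l
    have e4 := (dyad_anti hν (Nat.le_add_right j l)).trans hj
    have e5 := dyad_pos ν (j + l)
    have e6 := dyad_pos ν (j + l + 1)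
    set r : ℝ := (1 / 2) ^ (ν (j + l + 1) - ν (j + l))
    have hr : 0 < r := by positivity
    calc 2 * dyad ν (j + l + 1) * ((α + ℓ - α + 2 * dyad ν (j + l + 1)) / dyad ν (j + l) + 1)
        = 2 * r * (ℓ + 2 * dyad ν (j + l + 1) + dyad ν (j + l)) := by
          rw [show α + ℓ - α + 2 * dyad ν (j + l + 1) = ℓ + 2 * dyad ν (j + l + 1) by ring, e1]
          field_simp
      _ ≤ 2 * r * (9 * ℓ) := by gcongr; linarith
      _ = 18 * ℓ * r := by ring
      _ ≤ 18 * ℓ * (δ * (1 / 2) ^ l) := by gcongr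
      _ = _ := by ring
  have h2 : Icc α (α + ℓ) ∩ ⋃ k, ⋃ (_ : j ≤ k), slit ν k ⊆
      ⋃ l, (Icc α (α + ℓ) ∩ slit ν (j + l)) := by
    rintro x ⟨hx, hx2⟩
    simp only [mem_iUnion] at hx2 ⊢
    obtain ⟨k, hk, hxk⟩ := hx2
    exact ⟨k - j, hx, by rwa [Nat.add_sub_cancel' hk]⟩
  have hs : HasSum (fun l : ℕ => 18 * δ * ℓ * (1 / 2) ^ l) (36 * δ * ℓ) := by
    rw [show 36 * δ * ℓ = 18 * δ * ℓ * 2 by ring]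
    exact hasSum_geometric_two.mul_left _
  calc _ ≤ _ := measure_mono h2
    _ ≤ ∑' l, volume (Icc α (α + ℓ) ∩ slit ν (j + l)) := measure_iUnion_le _
    _ ≤ ∑' l, ENNReal.ofReal (18 * δ * ℓ * (1 / 2) ^ l) := ENNReal.tsum_le_tsum h1
    _ = _ := by
      rw [← ENNReal.ofReal_tsum_of_nonneg (fun l => by positivity) hs.summable, hs.tsum_eq]

theorem exists_cell {x η : ℝ} {a b : ℤ} (hη : 0 < η) (hab : a < b) (h1 : a * η ≤ x)
    (h2 : x ≤ b * η) : ∃ m : ℤ, a ≤ m ∧ m + 1 ≤ b ∧ m * η ≤ x ∧ x ≤ (m + 1) * η := by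
  rcases h2.eq_or_lt with h | h
  · refine ⟨b - 1, by omega, by omega, ?_, ?_⟩
    · push_cast; nlinarith
    · push_cast; linarith
  · refine ⟨⌊x / η⌋, ?_, ?_, ?_, ?_⟩
    · rw [Int.le_floor, le_div_iff₀ hη]; exact h1
    · have : ⌊x / η⌋ < b := by rw [Int.floor_lt, div_lt_iff₀ hη]; exact h
      omega
    · rw [← le_div_iff₀ hη]; exact Int.floor_le _
    · rw [← div_le_iff₀ hη]; exact (Int.lt_floor_add_one _).le

theorem abs_sub_lt_of_mem_slit {ν : ℕ → ℕ} (hν : ∀ k, 2 * ν k + k + 8 ≤ ν (k + 1))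
    {x : ℝ} {k : ℕ} {m : ℤ} (h1 : m * dyad ν k ≤ x)
    (h2 : x ≤ (m + 1) * dyad ν k) (hx : x ∈ slit ν k) :
    |x - (m * dyad ν k + dyad ν k / 2)| < dyad ν (k + 1) := by
  obtain ⟨m', hm'⟩ := hx
  have e1 := dyad_succ_le hν k
  have e2 := dyad_pos ν k
  have h3 := abs_lt.1 hm'
  have h4 : (m' : ℝ) < m + 1 := by
    by_contra hc; rw [not_lt] at hc; nlinarith
  have h5 : (m : ℝ) < m' + 1 := by
    by_contra hc; rw [not_lt] at hc; nlinarith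
  have h6 : m' = m := by
    have h4' : m' < m + 1 := by exact_mod_cast h4
    have h5' : m < m' + 1 := by exact_mod_cast h5
    omega
  rwa [h6] at hm'

theorem dyad_eq_mul {ν : ℕ → ℕ} {i j : ℕ} (h : ν i ≤ ν j) : dyad ν i = ((2 ^ (ν j - ν i) : ℤ) : ℝ) * dyad ν j := by
  unfold dyad
  obtain ⟨c, hc⟩ := Nat.exists_eq_add_of_le h
  rw [hc, Nat.add_sub_cancel_left, pow_add]
  have h2 : (2 : ℝ) ^ c * (1 / 2) ^ c = 1 := by rw [← mul_pow]; norm_num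
  push_cast
  linear_combination (-(1 / 2 : ℝ) ^ ν i) * h2

/-- One of the two halves of a cell minus the central slit; it contains `x`. -/
theorem exists_half_cell {ν : ℕ → ℕ} (hν : ∀ k, 2 * ν k + k + 8 ≤ ν (k + 1))
    {x : ℝ} {K : ℕ} {m : ℤ} (h1 : m * dyad ν K ≤ x)
    (h2 : x ≤ (m + 1) * dyad ν K) (hx : x ∉ slit ν K) :
    ∃ a b : ℤ, a < b ∧ m * dyad ν K ≤ a * dyad ν (K + 1) ∧ b * dyad ν (K + 1) ≤ (m + 1) * dyad ν K ∧
      a * dyad ν (K + 1) ≤ x ∧ x ≤ b * dyad ν (K + 1) ∧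
      dyad ν K / 4 ≤ b * dyad ν (K + 1) - a * dyad ν (K + 1) ∧
      ∀ y, a * dyad ν (K + 1) ≤ y → y ≤ b * dyad ν (K + 1) → y ∉ slit ν K := by
  have hg := hν K
  have e0 := dyad_succ_le hν K
  have e3 := dyad_pos ν (K + 1)
  obtain ⟨c, hc⟩ : ∃ c : ℤ, dyad ν K = (2 * c : ℤ) * dyad ν (K + 1) := by
    refine ⟨2 ^ (ν (K + 1) - ν K - 1), ?_⟩
    rw [dyad_eq_mul (i := K) (j := K + 1) (by omega), ← pow_succ']
    congr 4; omega
  push_cast at hc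
  have hc128 : (128 : ℝ) ≤ c := by
    by_contra hcc; rw [not_le] at hcc; nlinarith
  have hc128' : (128 : ℤ) ≤ c := by exact_mod_cast hc128
  have hx' : dyad ν (K + 1) ≤ |x - (m * dyad ν K + dyad ν K / 2)| := by
    by_contra hcc; rw [not_le] at hcc; exact hx ⟨m, hcc⟩
  set η := dyad ν (K + 1)
  rcases le_abs'.1 hx' with h | h
  · refine ⟨2 * c * m, 2 * c * m + c - 1, by omega, ?_, ?_, ?_, ?_, ?_, fun y hy1 hy2 hy => ?_⟩
    · rw [hc]; push_cast; linarith
    · rw [hc]; push_cast; nlinarith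
    · push_cast; rw [hc] at h1; linarith
    · push_cast; rw [hc] at h; linarith
    · push_cast; rw [hc]; nlinarith
    · push_cast at hy1 hy2
      have := abs_lt.1 (abs_sub_lt_of_mem_slit hν (m := m) (by rw [hc]; linarith)
        (by rw [hc]; nlinarith) hy)
      rw [hc] at this
      linarith [this.1]
  · refine ⟨2 * c * m + c + 1, 2 * c * m + 2 * c, by omega, ?_, ?_, ?_, ?_, ?_, fun y hy1 hy2 hy => ?_⟩
    · rw [hc]; push_cast; nlinarith
    · rw [hc]; push_cast; nlinarith
    · push_cast; rw [hc] at h; linarith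
    · push_cast; rw [hc] at h2; linarith
    · push_cast; rw [hc]; nlinarith
    · push_cast at hy1 hy2
      have := abs_lt.1 (abs_sub_lt_of_mem_slit hν (m := m) (by rw [hc]; nlinarith)
        (by rw [hc]; linarith) hy)
      rw [hc] at this
      linarith [this.2]

theorem exists_free_cell {ν : ℕ → ℕ} (hν : ∀ k, 2 * ν k + k + 8 ≤ ν (k + 1))
    {x : ℝ} (hx : x ∈ Icc (-1 : ℝ) 1) {i K : ℕ} (hiK : i ≤ K)
    (hfree : ∀ k, i ≤ k → k < K → x ∉ slit ν k) :
    ∃ m : ℤ, -1 ≤ m * dyad ν K ∧ (m + 1) * dyad ν K ≤ 1 ∧ m * dyad ν K ≤ x ∧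
      x ≤ (m + 1) * dyad ν K ∧ ∀ y, m * dyad ν K ≤ y → y ≤ (m + 1) * dyad ν K →
        ∀ k, i ≤ k → k < K → y ∉ slit ν k := by
  induction K, hiK using Nat.le_induction with
  | base =>
    have e : ((2 ^ ν i : ℤ) : ℝ) * dyad ν i = 1 := by
      unfold dyad; push_cast; rw [← mul_pow]; norm_num
    have e3 := dyad_pos ν i
    have hpos : (0 : ℤ) < 2 ^ ν i := by positivity
    obtain ⟨m, hm1, hm2, hm3, hm4⟩ := exists_cell (x := x) (a := -2 ^ ν i) (b := 2 ^ ν i) e3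
      (by omega) (by rw [Int.cast_neg, neg_mul, e]; exact hx.1) (by rw [e]; exact hx.2)
    refine ⟨m, ?_, ?_, hm3, hm4, fun y _ _ k h1 h2 => absurd h2 (by omega)⟩
    · have : ((-2 ^ ν i : ℤ) : ℝ) ≤ m := by exact_mod_cast hm1
      rw [Int.cast_neg] at this
      nlinarith
    · have : ((m + 1 : ℤ) : ℝ) ≤ ((2 ^ ν i : ℤ) : ℝ) := by exact_mod_cast hm2
      push_cast at this e
      nlinarith
  | succ K hiK ih =>
    obtain ⟨m, hm1, hm2, hm3, hm4, hm5⟩ := ih fun k h1 h2 => hfree k h1 (by omega)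
    obtain ⟨a, b, hab, h1, h2, h3, h4, -, h6⟩ :=
      exists_half_cell hν hm3 hm4 (hfree K hiK (by omega))
    obtain ⟨m', g1, g2, g3, g4⟩ := exists_cell (dyad_pos ν (K + 1)) hab h3 h4
    have e3 := dyad_pos ν (K + 1)
    have g1' : (a : ℝ) * dyad ν (K + 1) ≤ m' * dyad ν (K + 1) := by gcongr
    have g2' : ((m' : ℝ) + 1) * dyad ν (K + 1) ≤ b * dyad ν (K + 1) := by
      gcongr; exact_mod_cast g2
    refine ⟨m', by linarith, by linarith, g3, g4, fun y hy1 hy2 k hk1 hk2 => ?_⟩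
    rcases (Nat.lt_succ_iff.1 hk2).eq_or_lt with rfl | hk
    · exact h6 y (by linarith) (by linarith)
    · exact hm5 y (by linarith) (by linarith) k hk1 hk

theorem exists_subinterval {a b x ℓ : ℝ} (h1 : a ≤ x) (h2 : x ≤ b) (h3 : ℓ ≤ b - a) (h4 : 0 ≤ ℓ) :
    ∃ α, a ≤ α ∧ α + ℓ ≤ b ∧ x - ℓ ≤ α ∧ α ≤ x :=
  ⟨max a (x - ℓ), le_max_left _ _, by
    rw [← le_sub_iff_add_le]; exact max_le (by linarith) (by linarith), le_max_right _ _,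
    max_le h1 (by linarith)⟩

theorem le_volume_slitCompl_inter {ν : ℕ → ℕ} (hν : ∀ k, 2 * ν k + k + 8 ≤ ν (k + 1))
    {x ρ : ℝ} {i : ℕ} (hx : x ∈ Icc (-1 : ℝ) 1) (hρ0 : 0 < ρ)
    (hρ1 : ρ ≤ 1) (h : dyad ν i ≤ ρ ∨ x ∈ slitCompl ν i) :
    ENNReal.ofReal (ρ / 8) ≤ volume (slitCompl ν i ∩ Icc (x - ρ) (x + ρ)) := by
  obtain ⟨α, j, hα1, hα2, hα3, hα4, hj, hfree⟩ : ∃ (α : ℝ) (j : ℕ), -1 ≤ α ∧ α + ρ / 4 ≤ 1 ∧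
      x - ρ / 4 ≤ α ∧ α ≤ x ∧ dyad ν j ≤ ρ ∧
      ∀ y, α ≤ y → y ≤ α + ρ / 4 → ∀ k, i ≤ k → k < j → y ∉ slit ν k := by
    by_cases hi : dyad ν i ≤ ρ
    · obtain ⟨α, h1, h2, h3, h4⟩ := exists_subinterval (ℓ := ρ / 4) hx.1 hx.2
        (by linarith) (by linarith)
      exact ⟨α, i, h1, h2, h3, h4, hi, fun y _ _ k hk1 hk2 => absurd hk2 (by omega)⟩
    · have hxi := h.resolve_left hi
      have hex : ∃ k, dyad ν k ≤ ρ := by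
        obtain ⟨k, hk⟩ := exists_pow_lt_of_lt_one hρ0 (by norm_num : (1 / 2 : ℝ) < 1)
        exact ⟨k, (dyad_le hν k).trans hk.le⟩
      classical
      set j := Nat.find hex with hjdef
      have hj := Nat.find_spec hex
      have hij : i < j := by
        by_contra hc; rw [not_lt] at hc; exact hi ((dyad_anti hν hc).trans hj)
      obtain ⟨K, hK⟩ : ∃ K, j = K + 1 := ⟨j - 1, by omega⟩
      have hK2 : ρ < dyad ν K := not_le.1 (Nat.find_min hex (m := K) (by omega))
      obtain ⟨m, hm1, hm2, hm3, hm4, hm5⟩ :=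
        exists_free_cell hν hx (K := K) (i := i) (by omega) fun k hk _ => hxi.2 k hk
      obtain ⟨a, b, hab, h1, h2, h3, h4, h5, h6⟩ :=
        exists_half_cell hν hm3 hm4 (hxi.2 K (by omega))
      obtain ⟨α, g1, g2, g3, g4⟩ := exists_subinterval (ℓ := ρ / 4) h3 h4
        (by linarith) (by linarith)
      refine ⟨α, K + 1, by linarith, by linarith, g3, g4, by rw [← hK]; exact hj,
        fun y hy1 hy2 k hk1 hk2 => ?_⟩
      rcases (Nat.lt_succ_iff.1 hk2).eq_or_lt with rfl | hk
      · exact h6 y (by linarith) (by linarith)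
      · exact hm5 y (by linarith) (by linarith) k hk1 hk
  have hM := volume_Icc_inter_iUnion_slit_le hν (α := α) (ℓ := ρ / 4) (j := j) (by linarith)
  have hM2 : volume (Icc α (α + ρ / 4) ∩ ⋃ k, ⋃ (_ : j ≤ k), slit ν k) ≤
      ENNReal.ofReal (ρ / 8) := by
    refine hM.trans (ENNReal.ofReal_le_ofReal ?_)
    have h1 := ratio_le_pow hν j
    have h2 : (1 / 2 : ℝ) ^ (j + 8) ≤ 1 / 256 := by
      rw [pow_add]; have : (1 / 2 : ℝ) ^ j ≤ 1 := pow_le_one₀ (by norm_num) (by norm_num)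
      norm_num at this ⊢; linarith
    nlinarith
  have hsub : Icc α (α + ρ / 4) ⊆ (slitCompl ν i ∩ Icc (x - ρ) (x + ρ)) ∪
      (Icc α (α + ρ / 4) ∩ ⋃ k, ⋃ (_ : j ≤ k), slit ν k) := by
    intro y hy
    by_cases hys : y ∈ ⋃ k, ⋃ (_ : j ≤ k), slit ν k
    · exact Or.inr ⟨hy, hys⟩
    · refine Or.inl ⟨⟨⟨by linarith [hy.1], by linarith [hy.2]⟩, fun k hk => ?_⟩,
        by linarith [hy.1], by linarith [hy.2]⟩
      by_cases hkj : k < j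
      · exact hfree y hy.1 hy.2 k hk hkj
      · intro hc; apply hys; simp only [mem_iUnion]; exact ⟨k, by omega, hc⟩
  have h3 := (measure_mono (μ := volume) hsub).trans (measure_union_le _ _)
  rw [Real.volume_Icc] at h3
  have h4 := h3.trans (add_le_add_right hM2 _)
  have h5 : ENNReal.ofReal (α + ρ / 4 - α) = ENNReal.ofReal (ρ / 8) + ENNReal.ofReal (ρ / 8) := by
    rw [← ENNReal.ofReal_add (by positivity) (by positivity)]; congr 1; ring
  rw [h5] at h4
  exact (ENNReal.add_le_add_iff_right ENNReal.ofReal_ne_top).1 h4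

theorem volume_rectangle {A B : Set ℝ} (hA : MeasurableSet A) (hB : MeasurableSet B) :
    volume {z : Euc 2 | z 0 ∈ A ∧ z 1 ∈ B} = volume A * volume B := by
  have h1 := (EuclideanSpace.volume_preserving_symm_measurableEquiv_toLp (Fin 2))
  have h2 := (volume_preserving_finTwoArrow ℝ)
  have h3 := (h2.comp h1).measure_preimage (hA.prod hB).nullMeasurableSet
  rw [Measure.volume_eq_prod, Measure.prod_prod] at h3
  rw [← h3]
  rfl

/-- The coordinate swap of the Euclidean plane. -/
def swapEuc : Euc 2 ≃ₗᵢ[ℝ] Euc 2 := LinearIsometryEquiv.piLpCongrLeft 2 ℝ ℝ (Equiv.swap 0 1)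

@[simp] theorem swapEuc_zero (z : Euc 2) : swapEuc z 0 = z 1 := rfl

@[simp] theorem swapEuc_one (z : Euc 2) : swapEuc z 1 = z 0 := rfl

@[simp] theorem swapEuc_swapEuc (z : Euc 2) : swapEuc (swapEuc z) = z := by
  ext i; fin_cases i <;> rfl

theorem abs_coord_sub_le_dist (z w : Euc 2) (i : Fin 2) : |z i - w i| ≤ dist z w := by
  rw [dist_eq_norm]
  simpa using PiLp.norm_apply_le (z - w) i

theorem dist_lt_of_abs_le {z w : Euc 2} {r : ℝ} (hr : 0 < r) (h0 : |z 0 - w 0| ≤ r / 2)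
    (h1 : |z 1 - w 1| ≤ r / 2) : dist z w < r := by
  rw [EuclideanSpace.dist_eq, Fin.sum_univ_two, Real.sqrt_lt' hr, Real.dist_eq, Real.dist_eq]
  have a0 := abs_nonneg (z 0 - w 0)
  have a1 := abs_nonneg (z 1 - w 1)
  nlinarith

/-- The square `(-1,1)²` with vertical teeth over the slits of level in `S`. -/
def toothed (ν : ℕ → ℕ) (S : Set ℕ) : Set (Euc 2) :=
  {z | |z 0| < 1 ∧ (|z 1| < 1 ∨ ∃ k ∈ S, z 0 ∈ slit ν k ∧ |z 1| < 2 - (1 / 2) ^ (k + 1))}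

/-- The square `(-1,1)²` with vertical and horizontal teeth of level in `S`. -/
def crossToothed (ν : ℕ → ℕ) (S : Set ℕ) : Set (Euc 2) :=
  toothed ν S ∪ swapEuc ⁻¹' toothed ν S

/-- The part of the boundary of `crossToothed ν univ` lying above and below the square. -/
def toothBdry (ν : ℕ → ℕ) : Set (Euc 2) :=
  {z | |z 0| ≤ 1 ∧ 1 ≤ |z 1| ∧ |z 1| ≤ 2 ∧ ∀ k, z 0 ∈ slit ν k → 2 - (1 / 2) ^ (k + 1) ≤ |z 1|}

theorem toothed_mono (ν : ℕ → ℕ) {S T : Set ℕ} (h : S ⊆ T) : toothed ν S ⊆ toothed ν T :=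
  fun _ hz => ⟨hz.1, hz.2.imp id fun ⟨k, hk, hz⟩ => ⟨k, h hk, hz⟩⟩

theorem crossToothed_mono (ν : ℕ → ℕ) {S T : Set ℕ} (h : S ⊆ T) :
    crossToothed ν S ⊆ crossToothed ν T :=
  union_subset_union (toothed_mono ν h) (preimage_mono (toothed_mono ν h))

theorem isOpen_toothed (ν : ℕ → ℕ) (S : Set ℕ) : IsOpen (toothed ν S) := by
  have : toothed ν S = {z | |z 0| < 1} ∩ ({z | |z 1| < 1} ∪
      ⋃ k ∈ S, ((fun z : Euc 2 => z 0) ⁻¹' slit ν k ∩ {z | |z 1| < 2 - (1 / 2) ^ (k + 1)})) := by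
    ext z; simp [toothed, and_left_comm]
  rw [this]
  refine (isOpen_lt (by fun_prop) (by fun_prop)).inter
    ((isOpen_lt (by fun_prop) (by fun_prop)).union ?_)
  refine isOpen_biUnion fun k _ => ?_
  exact ((isOpen_slit ν k).preimage (by fun_prop)).inter (isOpen_lt (by fun_prop) (by fun_prop))

theorem isOpen_crossToothed (ν : ℕ → ℕ) (S : Set ℕ) : IsOpen (crossToothed ν S) :=
  (isOpen_toothed ν S).union ((isOpen_toothed ν S).preimage swapEuc.continuous)

theorem isClosed_toothBdry (ν : ℕ → ℕ) : IsClosed (toothBdry ν) := by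
  have : toothBdry ν = {z | |z 0| ≤ 1} ∩ ({z | 1 ≤ |z 1|} ∩ ({z | |z 1| ≤ 2} ∩
      ⋂ k, ((fun z : Euc 2 => z 0) ⁻¹' (slit ν k)ᶜ ∪ {z | 2 - (1 / 2) ^ (k + 1) ≤ |z 1|}))) := by
    ext z; simp [toothBdry, imp_iff_not_or]
  rw [this]
  refine (isClosed_le (by fun_prop) (by fun_prop)).inter
    ((isClosed_le (by fun_prop) (by fun_prop)).inter
      ((isClosed_le (by fun_prop) (by fun_prop)).inter (isClosed_iInter fun k => ?_)))
  exact ((isOpen_slit ν k).isClosed_compl.preimage (by fun_prop)).union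
    (isClosed_le (by fun_prop) (by fun_prop))

theorem toothed_subset (ν : ℕ → ℕ) (S : Set ℕ) :
    toothed ν S ⊆ {z | |z 0| < 1 ∧ |z 1| < 2} := by
  rintro z ⟨h0, h | ⟨k, -, -, h⟩⟩
  · exact ⟨h0, by linarith⟩
  · exact ⟨h0, by have : (0 : ℝ) < (1 / 2) ^ (k + 1) := by positivity
                  linarith⟩

theorem square_subset_toothed (ν : ℕ → ℕ) (S : Set ℕ) :
    {z : Euc 2 | |z 0| < 1 ∧ |z 1| < 1} ⊆ toothed ν S := fun _ hz => ⟨hz.1, Or.inl hz.2⟩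

theorem zero_mem_toothed (ν : ℕ → ℕ) (S : Set ℕ) : (0 : Euc 2) ∈ toothed ν S :=
  square_subset_toothed ν S (by simp)

theorem convex_setOf_abs_coord_lt (i : Fin 2) (c : ℝ) : Convex ℝ {z : Euc 2 | |z i| < c} := by
  have : {z : Euc 2 | |z i| < c} = (EuclideanSpace.proj (𝕜 := ℝ) i : Euc 2 →L[ℝ] ℝ) ⁻¹' Ioo (-c) c := by
    ext z; simp [abs_lt]
  rw [this]
  exact (convex_Ioo _ _).linear_preimage (EuclideanSpace.proj (𝕜 := ℝ) i : Euc 2 →L[ℝ] ℝ).toLinearMap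

theorem convex_vertical (a c : ℝ) : Convex ℝ {z : Euc 2 | z 0 = a ∧ |z 1| < c} := by
  have : {z : Euc 2 | z 0 = a ∧ |z 1| < c} =
      (EuclideanSpace.proj (𝕜 := ℝ) 0 : Euc 2 →L[ℝ] ℝ) ⁻¹' {a} ∩ {z : Euc 2 | |z 1| < c} := by
    ext z; simp
  rw [this]
  exact ((convex_singleton _).linear_preimage
    (EuclideanSpace.proj (𝕜 := ℝ) 0 : Euc 2 →L[ℝ] ℝ).toLinearMap).inter (convex_setOf_abs_coord_lt 1 c)

theorem isPreconnected_toothed (ν : ℕ → ℕ) (S : Set ℕ) : IsPreconnected (toothed ν S) := by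
  have hsq : IsPreconnected {z : Euc 2 | |z 0| < 1 ∧ |z 1| < 1} :=
    ((convex_setOf_abs_coord_lt 0 1).inter (convex_setOf_abs_coord_lt 1 1)).isPreconnected
  refine isPreconnected_of_forall 0 fun z hz => ?_
  rcases hz with ⟨h0, h1 | ⟨k, hkS, hk, h1⟩⟩
  · exact ⟨_, square_subset_toothed ν S, by simp, ⟨h0, h1⟩, hsq⟩
  · have hpos : (1 / 2 : ℝ) ^ (k + 1) < 2 :=
      (pow_le_one₀ (by norm_num) (by norm_num)).trans_lt one_lt_two
    refine ⟨{z : Euc 2 | |z 0| < 1 ∧ |z 1| < 1} ∪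
      {w : Euc 2 | w 0 = z 0 ∧ |w 1| < 2 - (1 / 2) ^ (k + 1)}, ?_, Or.inl (by simp),
      Or.inr ⟨rfl, h1⟩, ?_⟩
    · refine union_subset (square_subset_toothed ν S) fun w hw => ?_
      exact ⟨by rw [hw.1]; exact h0, Or.inr ⟨k, hkS, by rw [hw.1]; exact hk, hw.2⟩⟩
    · refine hsq.union !₂[z 0, 0] ?_ ?_ (convex_vertical _ _).isPreconnected
      · simpa using h0
      · simpa using hpos

theorem swapEuc_preimage_eq_image (A : Set (Euc 2)) : swapEuc ⁻¹' A = swapEuc '' A := by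
  ext z
  exact ⟨fun h => ⟨_, h, swapEuc_swapEuc z⟩, by rintro ⟨w, hw, rfl⟩; simpa using hw⟩

theorem isConnected_crossToothed (ν : ℕ → ℕ) (S : Set ℕ) : IsConnected (crossToothed ν S) := by
  have h0 := zero_mem_toothed ν S
  refine ⟨⟨0, Or.inl h0⟩, ?_⟩
  refine (isPreconnected_toothed ν S).union 0 h0 (by simpa using h0) ?_
  rw [swapEuc_preimage_eq_image]
  exact (isPreconnected_toothed ν S).image _ swapEuc.continuous.continuousOn

theorem swapEuc_mem_crossToothed {ν : ℕ → ℕ} {S : Set ℕ} {z : Euc 2} :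
    swapEuc z ∈ crossToothed ν S ↔ z ∈ crossToothed ν S := by
  simp [crossToothed, or_comm]

theorem crossToothed_subset_ball (ν : ℕ → ℕ) (S : Set ℕ) : crossToothed ν S ⊆ ball 0 4 := by
  rintro z (h | h) <;> have h' := toothed_subset _ _ h <;>
    simp only [mem_ofPred_eq, swapEuc_zero, swapEuc_one] at h' <;>
    exact dist_lt_of_abs_le (by norm_num) (by simp; linarith [h'.1, h'.2])
      (by simp; linarith [h'.1, h'.2])

theorem compl_crossToothed_nonempty (ν : ℕ → ℕ) (S : Set ℕ) : (crossToothed ν S)ᶜ.Nonempty := by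
  refine ⟨!₂[4, 0], fun h => ?_⟩
  have h1 := crossToothed_subset_ball ν S h
  rw [mem_ball, dist_comm] at h1
  have h2 := (abs_coord_sub_le_dist (0 : Euc 2) !₂[4, 0] 0).trans_lt h1
  norm_num at h2

theorem abs_ne_one_of_mem_slit {ν : ℕ → ℕ} (hν : ∀ k, 2 * ν k + k + 8 ≤ ν (k + 1))
    {x : ℝ} {k : ℕ} (hx : x ∈ slit ν k) : |x| ≠ 1 := by
  intro h
  obtain ⟨m, hm⟩ := hx
  have e0 := dyad_succ_le hν k
  have e1 := dyad_pos ν k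
  obtain ⟨n, hn⟩ : ∃ n : ℤ, x = n * dyad ν k := by
    have e : ((2 ^ ν k : ℤ) : ℝ) * dyad ν k = 1 := by
      unfold dyad; push_cast; rw [← mul_pow]; norm_num
    rcases eq_or_eq_neg_of_abs_eq h with h | h
    · exact ⟨2 ^ ν k, by rw [e, h]⟩
    · exact ⟨-2 ^ ν k, by rw [Int.cast_neg, neg_mul, e, h]⟩
  rw [hn] at hm
  have h3 := abs_lt.1 hm
  have h4 : (m : ℝ) < n := by by_contra hc; rw [not_lt] at hc; nlinarith
  have h5 : (n : ℝ) < m + 1 := by by_contra hc; rw [not_lt] at hc; nlinarith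
  have h4' : m < n := by exact_mod_cast h4
  have h5' : n < m + 1 := by exact_mod_cast h5
  omega

theorem mem_or_mem_toothBdry {ν : ℕ → ℕ} (hν : ∀ k, 2 * ν k + k + 8 ≤ ν (k + 1))
    {z : Euc 2} (h0 : |z 0| ≤ 1) (h1 : 1 ≤ |z 1|) (h2 : |z 1| ≤ 2) :
    z ∈ toothed ν univ ∨ z ∈ toothBdry ν := by
  by_cases h : ∃ k, z 0 ∈ slit ν k ∧ |z 1| < 2 - (1 / 2) ^ (k + 1)
  · obtain ⟨k, hk, hk2⟩ := h
    exact Or.inl ⟨lt_of_le_of_ne h0 (abs_ne_one_of_mem_slit hν hk), Or.inr ⟨k, mem_univ _, hk, hk2⟩⟩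
  · push Not at h
    exact Or.inr ⟨h0, h1, h2, h⟩

theorem toothBdry_disjoint {ν : ℕ → ℕ} (z : Euc 2) (hz : z ∈ toothBdry ν) : z ∉ crossToothed ν univ := by
  obtain ⟨h0, h1, h2, h3⟩ := hz
  rintro (⟨-, h | ⟨k, -, hk, h⟩⟩ | ⟨h, -⟩)
  · linarith
  · linarith [h3 k hk]
  · simp only [swapEuc_zero] at h; linarith

theorem toothBdry_subset_closure {ν : ℕ → ℕ} (hν : ∀ k, 2 * ν k + k + 8 ≤ ν (k + 1))
    : toothBdry ν ⊆ closure (crossToothed ν univ) := by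
  rintro z ⟨h0, h1, h2, -⟩
  rw [Metric.mem_closure_iff]
  intro ε hε
  obtain ⟨k, hk⟩ := exists_pow_lt_of_lt_one (show (0 : ℝ) < ε / 2 by positivity)
    (by norm_num : (1 / 2 : ℝ) < 1)
  have e : ((2 ^ ν k : ℤ) : ℝ) * dyad ν k = 1 := by
    unfold dyad; push_cast; rw [← mul_pow]; norm_num
  have e3 := dyad_pos ν k
  have e4 := dyad_le hν k
  have hpos : (0 : ℤ) < 2 ^ ν k := by positivity
  have hz := abs_le.1 h0
  obtain ⟨m, hm1, hm2, hm3, hm4⟩ := exists_cell (x := z 0) (a := -2 ^ ν k) (b := 2 ^ ν k) e3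
    (by omega) (by rw [Int.cast_neg, neg_mul, e]; exact hz.1) (by rw [e]; exact hz.2)
  have hm1' : ((-2 ^ ν k : ℤ) : ℝ) ≤ m := by exact_mod_cast hm1
  have hm2' : ((m + 1 : ℤ) : ℝ) ≤ ((2 ^ ν k : ℤ) : ℝ) := by exact_mod_cast hm2
  rw [Int.cast_neg] at hm1'
  push_cast at hm2' e hm1'
  set q : ℝ := (1 / 2) ^ (k + 1) with hq
  have hq0 : 0 < q := by positivity
  have hq1 : q ≤ 1 / 2 := by
    rw [hq, pow_succ]; have : (1 / 2 : ℝ) ^ k ≤ 1 := pow_le_one₀ (by norm_num) (by norm_num)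
    linarith
  have hqk : (1 / 2 : ℝ) ^ k = 2 * q := by rw [hq, pow_succ]; ring
  refine ⟨!₂[m * dyad ν k + dyad ν k / 2, z 1 * (1 - q)], Or.inl ⟨?_, Or.inr ⟨k, mem_univ _, ?_, ?_⟩⟩, ?_⟩
  · simp only [Matrix.cons_val_zero]
    rw [abs_lt]; constructor <;> nlinarith
  · exact ⟨m, by simpa using dyad_pos ν (k + 1)⟩
  · simp only [Matrix.cons_val_one, Matrix.cons_val_fin_one]
    rw [abs_mul, abs_of_pos (by linarith : 0 < 1 - q)]
    nlinarith
  · apply dist_lt_of_abs_le hε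
    · simp only [Matrix.cons_val_zero]
      rw [abs_le]; constructor <;> nlinarith
    · simp only [Matrix.cons_val_one, Matrix.cons_val_fin_one]
      rw [show z 1 - z 1 * (1 - q) = z 1 * q by ring, abs_mul, abs_of_pos hq0]
      nlinarith

theorem frontier_crossToothed {ν : ℕ → ℕ} (hν : ∀ k, 2 * ν k + k + 8 ≤ ν (k + 1)) :
    frontier (crossToothed ν univ) = toothBdry ν ∪ swapEuc ⁻¹' toothBdry ν := by
  rw [(isOpen_crossToothed ν univ).frontier_eq]
  apply Subset.antisymm
  · rintro z ⟨hz, hzG⟩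
    have hQ : z ∈ {z : Euc 2 | |z 0| ≤ 1 ∧ |z 1| ≤ 2} ∪ {z : Euc 2 | |z 1| ≤ 1 ∧ |z 0| ≤ 2} := by
      refine closure_minimal (t := {z : Euc 2 | |z 0| ≤ 1 ∧ |z 1| ≤ 2} ∪
        {z : Euc 2 | |z 1| ≤ 1 ∧ |z 0| ≤ 2}) ?_ ?_ hz
      · rintro w (hw | hw)
        · have := toothed_subset _ _ hw; exact Or.inl ⟨this.1.le, this.2.le⟩
        · have := toothed_subset _ _ hw; exact Or.inr ⟨this.1.le, this.2.le⟩
      · have hc : ∀ (i : Fin 2) (c : ℝ), IsClosed {z : Euc 2 | |z i| ≤ c} := fun i c =>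
          isClosed_le (by fun_prop) (by fun_prop)
        exact ((hc 0 1).inter (hc 1 2)).union ((hc 1 1).inter (hc 0 2))
    have key1 : |z 0| ≤ 1 → 1 ≤ |z 1| → |z 1| ≤ 2 → z ∈ toothBdry ν := fun a b c =>
      (mem_or_mem_toothBdry hν a b c).resolve_left fun h => hzG (Or.inl h)
    have key2 : |z 1| ≤ 1 → 1 ≤ |z 0| → |z 0| ≤ 2 → swapEuc z ∈ toothBdry ν := fun a b c =>
      (mem_or_mem_toothBdry hν (z := swapEuc z) a b c).resolve_left fun h => hzG (Or.inr h)
    rcases lt_or_ge |z 0| 1 with h0 | h0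
    · rcases lt_or_ge |z 1| 1 with h1 | h1
      · exact absurd (Or.inl ⟨h0, Or.inl h1⟩) hzG
      · refine Or.inl (key1 h0.le h1 ?_)
        rcases hQ with h | h
        · exact h.2
        · linarith [h.1]
    · rcases lt_or_ge |z 1| 1 with h1 | h1
      · refine Or.inr (key2 h1.le h0 ?_)
        rcases hQ with h | h
        · linarith [h.1]
        · exact h.2
      · rcases hQ with h | h
        · exact Or.inl (key1 h.1 h1 h.2)
        · exact Or.inr (key2 h.1 h0 h.2)
  · rintro z (hz | hz)
    · exact ⟨toothBdry_subset_closure hν hz, toothBdry_disjoint z hz⟩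
    · refine ⟨?_, fun h => toothBdry_disjoint _ hz (swapEuc_mem_crossToothed.2 h)⟩
      have h1 : crossToothed ν univ = swapEuc ⁻¹' crossToothed ν univ := by
        ext w; exact swapEuc_mem_crossToothed.symm
      have h2 := swapEuc.toHomeomorph.preimage_closure (crossToothed ν univ)
      rw [h1]
      change z ∈ closure (swapEuc.toHomeomorph ⁻¹' crossToothed ν univ)
      rw [← h2]
      exact toothBdry_subset_closure hν hz

/-- Choice of the level at which to look at the tooth boundary at scale `ρ`. -/
theorem exists_level {ν : ℕ → ℕ} (hν : ∀ k, 2 * ν k + k + 8 ≤ ν (k + 1))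
    {x t ρ : ℝ} (hx : x ∈ Icc (-1 : ℝ) 1) (ht : 1 ≤ t) (hρ0 : 0 < ρ) (hρ1 : ρ ≤ 1)
    (h : ∀ k, x ∈ slit ν k → 2 - (1 / 2) ^ (k + 1) ≤ t) :
    ∃ i, ρ / 2 ≤ (1 / 2) ^ i ∧ 2 - (1 / 2) ^ i ≤ t ∧ (dyad ν i ≤ ρ ∨ x ∈ slitCompl ν i) := by
  obtain ⟨n, hn1, hn2⟩ := exists_nat_pow_near_of_lt_one hρ0 hρ1 (by norm_num : (0 : ℝ) < 1 / 2)
    (by norm_num)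
  by_cases hc : 2 - (1 / 2) ^ (n + 1) ≤ t
  · exact ⟨n + 1, by rw [pow_succ]; linarith, hc, Or.inl ((dyad_le hν _).trans hn1.le)⟩
  · have hex : ∃ i, ¬ (2 - (1 / 2) ^ i ≤ t) := ⟨_, hc⟩
    classical
    have hj := Nat.find_spec hex
    have hjn := Nat.find_min' hex hc
    have hmin := fun m => Nat.find_min hex (m := m)
    generalize Nat.find hex = j at hj hjn hmin
    have hj0 : j ≠ 0 := by
      intro h0; rw [h0] at hj; apply hj; norm_num; exact ht
    obtain ⟨i, rfl⟩ : ∃ i, j = i + 1 := ⟨j - 1, by omega⟩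
    refine ⟨i, ?_, not_not.1 (hmin i (by omega)), Or.inr ⟨hx, fun k hk hxk => hj ?_⟩⟩
    · have : (1 / 2 : ℝ) ^ n ≤ (1 / 2) ^ i :=
        pow_le_pow_of_le_one (by norm_num) (by norm_num) (by omega)
      linarith
    · have : (1 / 2 : ℝ) ^ (k + 1) ≤ (1 / 2) ^ (i + 1) :=
        pow_le_pow_of_le_one (by norm_num) (by norm_num) (by omega)
      linarith [h k hxk]

theorem le_volume_ball_inter_toothBdry {ν : ℕ → ℕ} (hν : ∀ k, 2 * ν k + k + 8 ≤ ν (k + 1))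
    {z : Euc 2} (hz : z ∈ toothBdry ν) {r : ℝ} (hr0 : 0 < r)
    (hr1 : r < 1) : ENNReal.ofReal (1 / 64 * r ^ 2) ≤ volume (ball z r ∩ toothBdry ν) := by
  obtain ⟨h0, h1, h2, h3⟩ := hz
  have hx : z 0 ∈ Icc (-1 : ℝ) 1 := abs_le.1 h0
  obtain ⟨i, hi1, hi2, hi3⟩ := exists_level hν hx h1 (ρ := r / 2) (by positivity) (by linarith) h3
  have hA := le_volume_slitCompl_inter hν hx (ρ := r / 2) (by positivity) (by linarith) hi3
  obtain ⟨α, g1, g2, g3, g4⟩ := exists_subinterval (ℓ := r / 2 / 2) hi2 h2 (by linarith)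
    (by positivity)
  have hiq : (1 / 2 : ℝ) ^ i ≤ 1 := pow_le_one₀ (by norm_num) (by norm_num)
  obtain ⟨B, hBm, hBv, hB⟩ : ∃ B : Set ℝ, MeasurableSet B ∧ volume B = ENNReal.ofReal (r / 4) ∧
      ∀ y ∈ B, α ≤ |y| ∧ |y| ≤ α + r / 4 ∧ |y - z 1| ≤ r / 2 := by
    rcases le_total 0 (z 1) with hs | hs
    · rw [abs_of_nonneg hs] at *
      refine ⟨Icc α (α + r / 4), measurableSet_Icc, by rw [Real.volume_Icc]; congr 1; ring,
        fun y hy => ?_⟩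
      rw [abs_of_nonneg (by linarith [hy.1] : 0 ≤ y), abs_le]
      exact ⟨hy.1, hy.2, by linarith [hy.1], by linarith [hy.2]⟩
    · rw [abs_of_nonpos hs] at *
      refine ⟨Icc (-(α + r / 4)) (-α), measurableSet_Icc, by rw [Real.volume_Icc]; congr 1; ring,
        fun y hy => ?_⟩
      rw [abs_of_nonpos (by linarith [hy.2] : y ≤ 0), abs_le]
      exact ⟨by linarith [hy.2], by linarith [hy.1], by linarith [hy.1], by linarith [hy.2]⟩
  have hAm : MeasurableSet (slitCompl ν i ∩ Icc (z 0 - r / 2) (z 0 + r / 2)) :=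
    (isClosed_slitCompl ν i).measurableSet.inter measurableSet_Icc
  calc ENNReal.ofReal (1 / 64 * r ^ 2) = ENNReal.ofReal (r / 2 / 8) * ENNReal.ofReal (r / 4) := by
        rw [← ENNReal.ofReal_mul (by positivity)]; congr 1; ring
    _ ≤ _ := mul_le_mul' hA hBv.ge
    _ = _ := (volume_rectangle hAm hBm).symm
    _ ≤ _ := measure_mono ?_
  rintro w ⟨⟨hw1, hw2⟩, hw3⟩
  obtain ⟨b1, b2, b3⟩ := hB _ hw3
  refine ⟨dist_lt_of_abs_le hr0 ?_ b3, abs_le.2 hw1.1, by linarith, by linarith, fun k hk => ?_⟩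
  · rw [abs_le]; exact ⟨by linarith [hw2.1], by linarith [hw2.2]⟩
  · have hki : k + 1 ≤ i := by
      by_contra hc; exact hw1.2 k (by omega) hk
    have : (1 / 2 : ℝ) ^ i ≤ (1 / 2) ^ (k + 1) :=
      pow_le_pow_of_le_one (by norm_num) (by norm_num) hki
    linarith

theorem le_volume_ball_inter_frontier {ν : ℕ → ℕ} (hν : ∀ k, 2 * ν k + k + 8 ≤ ν (k + 1))
    {z : Euc 2} (hz : z ∈ frontier (crossToothed ν univ)) {r : ℝ}
    (hr0 : 0 < r) (hr1 : r < 1) :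
    ENNReal.ofReal (1 / 64 * r ^ 2) ≤ volume (ball z r ∩ frontier (crossToothed ν univ)) := by
  rw [frontier_crossToothed hν] at hz ⊢
  rcases hz with hz | hz
  · exact (le_volume_ball_inter_toothBdry hν hz hr0 hr1).trans
      (measure_mono (inter_subset_inter_right _ subset_union_left))
  · refine (le_volume_ball_inter_toothBdry hν hz hr0 hr1).trans ?_
    rw [← swapEuc.measurePreserving.measure_preimage
      (measurableSet_ball.inter (isClosed_toothBdry ν).measurableSet).nullMeasurableSet]
    apply measure_mono
    rintro w ⟨hw1, hw2⟩
    exact ⟨by simpa using hw1, Or.inr hw2⟩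

theorem locallyUniformlyFat_frontier_crossToothed {ν : ℕ → ℕ} (hν : ∀ k, 2 * ν k + k + 8 ≤ ν (k + 1))
    {s p : ℝ} (hp1 : 1 < p) (hs0 : 0 < s)
    (hs2 : s < 2) (hsp : s * p < 2) :
    LocallyUniformlyFat 2 s p (frontier (crossToothed ν univ)) := by
  obtain ⟨σ, hσ, h⟩ := exists_le_rieszCap_of_le_volume hp1 hs0 hs2 hsp
    (c := 1 / 64) (by norm_num)
  refine ⟨σ, 1, hσ, one_pos, fun x hx r hr0 hr1 => ?_⟩
  exact_mod_cast h x r _ hr0 (measurableSet_ball.inter isClosed_frontier.measurableSet)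
    inter_subset_left (le_volume_ball_inter_frontier hν hx hr0 hr1)

open scoped Convolution in
/-- A smooth cutoff function at scale `ε` from the boundary of a bounded open set. -/
theorem exists_smooth_cutoff {U : Set (Euc 2)} (hU : Bornology.IsBounded U) {ε : ℝ} (hε : 0 < ε) :
    ∃ u : Euc 2 → ℝ, ContDiff ℝ (⊤ : ℕ∞) u ∧ HasCompactSupport u ∧ tsupport u ⊆ U ∧
      (∀ x y, |u x - u y| ≤ min 1 (dist x y / ε)) ∧ ∀ x, 4 * ε ≤ infDist x Uᶜ → u x = 1 := by
  set v : Euc 2 → ℝ := fun x => min 1 (max 0 (infDist x Uᶜ / ε - 2)) with hv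
  have hvc : Continuous v := by fun_prop
  have hv0 : ∀ x, 0 ≤ v x := fun x => le_min zero_le_one (le_max_left _ _)
  have hv1 : ∀ x, v x ≤ 1 := fun x => min_le_left _ _
  have hΦ : ∀ x y, infDist x Uᶜ ≤ infDist y Uᶜ + dist x y := fun x y => infDist_le_infDist_add_dist
  have hvl : ∀ x y, v x - v y ≤ dist x y / ε := by
    intro x y
    have h2 : infDist x Uᶜ / ε ≤ infDist y Uᶜ / ε + dist x y / ε := by
      rw [← add_div]; gcongr; exact hΦ x y
    have h3 : 0 ≤ dist x y / ε := by positivity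
    simp only [hv]
    rcases le_total 1 (max 0 (infDist y Uᶜ / ε - 2)) with h | h
    · rw [min_eq_left h]; linarith [min_le_left 1 (max 0 (infDist x Uᶜ / ε - 2))]
    · rw [min_eq_right h]
      have h4 := min_le_right 1 (max 0 (infDist x Uᶜ / ε - 2))
      have h5 : max 0 (infDist x Uᶜ / ε - 2) ≤ max 0 (infDist y Uᶜ / ε - 2) + dist x y / ε :=
        max_le (by linarith [le_max_left 0 (infDist y Uᶜ / ε - 2)])
          (by linarith [le_max_right 0 (infDist y Uᶜ / ε - 2)])
      linarith
  let φ : ContDiffBump (0 : Euc 2) := ⟨ε / 2, ε, by positivity, by linarith⟩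
  set u : Euc 2 → ℝ := φ.normed volume ⋆[ContinuousLinearMap.lsmul ℝ ℝ, volume] v with hu
  have hu_eq : ∀ x, u x = ∫ t, φ.normed volume t * v (x - t) := fun x => by
    rw [hu, convolution_def]; simp
  have hint : ∀ x, Integrable (fun t => φ.normed volume t * v (x - t)) := fun x => by
    refine Continuous.integrable_of_hasCompactSupport
      (φ.continuous_normed.mul (by fun_prop)) φ.hasCompactSupport_normed.mul_right
  have hint1 : Integrable (φ.normed (volume : Measure (Euc 2))) := φ.integrable_normed
  have hu0 : ∀ x, 0 ≤ u x := fun x => by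
    rw [hu_eq]; exact integral_nonneg fun t => mul_nonneg (φ.nonneg_normed t) (hv0 _)
  have hu1 : ∀ x, u x ≤ 1 := fun x => by
    rw [hu_eq, ← φ.integral_normed (μ := volume)]
    exact integral_mono (hint x) hint1 fun t =>
      mul_le_of_le_one_right (φ.nonneg_normed t) (hv1 _)
  have hul : ∀ x y, u x - u y ≤ dist x y / ε := fun x y => by
    rw [hu_eq, hu_eq, ← integral_sub (hint x) (hint y)]
    calc _ ≤ ∫ t, φ.normed volume t * (dist x y / ε) := by
          refine integral_mono ((hint x).sub (hint y)) (hint1.mul_const _) fun t => ?_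
          rw [← mul_sub]
          refine mul_le_mul_of_nonneg_left ?_ (φ.nonneg_normed t)
          simpa using hvl (x - t) (y - t)
      _ = dist x y / ε := by rw [integral_mul_const, φ.integral_normed, one_mul]
  have hu_one : ∀ x, 4 * ε ≤ infDist x Uᶜ → u x = 1 := fun x hx => by
    have hone : ∀ y ∈ ball x ε, v y = 1 := fun y hy => by
      have h1 := hΦ x y
      rw [dist_comm] at h1
      have h2 : 3 ≤ infDist y Uᶜ / ε := by
        rw [le_div_iff₀ hε]; linarith [mem_ball.1 hy]
      simp only [hv]
      rw [min_eq_left]; exact le_max_of_le_right (by linarith)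
    rw [hu, φ.normed_convolution_eq_right, hone x (mem_ball_self hε)]
    exact fun y hy => by rw [hone y hy, hone x (mem_ball_self hε)]
  have hu_zero : ∀ x, infDist x Uᶜ < ε → u x = 0 := fun x hx => by
    have hzero : ∀ y ∈ ball x ε, v y = 0 := fun y hy => by
      have h1 := hΦ y x
      have h2 : infDist y Uᶜ / ε ≤ 2 := by
        rw [div_le_iff₀ hε]; linarith [mem_ball.1 hy]
      simp only [hv]
      rw [max_eq_left (by linarith)]; simp
    rw [hu, φ.normed_convolution_eq_right, hzero x (mem_ball_self hε)]
    exact fun y hy => by rw [hzero y hy, hzero x (mem_ball_self hε)]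
  have hsupp : tsupport u ⊆ {x | ε ≤ infDist x Uᶜ} := by
    refine closure_minimal (fun x hx => ?_) (isClosed_le continuous_const (by fun_prop))
    by_contra hc
    exact hx (hu_zero x (not_le.1 hc))
  have hsuppU : tsupport u ⊆ U := fun x hx => by
    by_contra hc
    have h1 : ε ≤ infDist x Uᶜ := hsupp hx
    rw [infDist_zero_of_mem hc] at h1
    linarith
  refine ⟨u, ?_, ?_, hsuppU, fun x y => ?_, hu_one⟩
  · exact φ.hasCompactSupport_normed.contDiff_convolution_left _ φ.contDiff_normed
      (hvc.locallyIntegrable)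
  · exact Metric.isCompact_of_isClosed_isBounded (isClosed_tsupport u) (hU.subset hsuppU)
  · rw [abs_le]
    have := hul x y; have h2 := hul y x; rw [dist_comm] at h2
    constructor
    · rw [neg_le]; exact le_min (by linarith [hu0 x, hu1 y]) (by linarith)
    · exact le_min (by linarith [hu0 y, hu1 x]) (by linarith)

theorem exists_gagliardo_le {p a : ℝ} (ha0 : 0 < a) (hap : a < p) :
    ∃ C : ℝ, 0 < C ∧ ∀ (ε : ℝ) (G : Set (Euc 2)) (u : Euc 2 → ℝ), 0 < ε → MeasurableSet G →
      Continuous u → (∀ x y, |u x - u y| ≤ min 1 (dist x y / ε)) →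
      ∫⁻ x in G, ∫⁻ y in G, ENNReal.ofReal (|u x - u y| ^ p / dist x y ^ (2 + a)) ≤
        ENNReal.ofReal (C * ε ^ (-a)) * volume {z ∈ G | u z ≠ 1} := by
  obtain ⟨C, hC, hK⟩ := exists_lintegral_min_rpow_div_le ha0 hap
  refine ⟨2 * C, by positivity, fun ε G u hε hG hu hlip => ?_⟩
  set B := {z ∈ G | u z ≠ 1} with hB
  have hBm : MeasurableSet B :=
    hG.inter ((isClosed_singleton (x := (1 : ℝ))).isOpen_compl.preimage hu).measurableSet
  obtain ⟨K, hKdef⟩ : ∃ K : Euc 2 → Euc 2 → ℝ≥0∞, K = fun x y =>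
    ENNReal.ofReal (min 1 (dist x y / ε) ^ p / dist x y ^ (2 + a)) := ⟨_, rfl⟩
  have hKm : Measurable (Function.uncurry K) := by
    simp only [hKdef, Function.uncurry_def]; fun_prop
  have hKsymm : ∀ x y, K x y = K y x := fun x y => by simp only [hKdef, dist_comm]
  have hpt : ∀ x ∈ G, ∀ y ∈ G, ENNReal.ofReal (|u x - u y| ^ p / dist x y ^ (2 + a)) ≤
      B.indicator 1 x * K x y + B.indicator 1 y * K x y := by
    intro x hx y hy
    have h1 : ENNReal.ofReal (|u x - u y| ^ p / dist x y ^ (2 + a)) ≤ K x y := by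
      rw [hKdef]
      apply ENNReal.ofReal_le_ofReal
      gcongr
      · linarith
      · exact hlip x y
    by_cases hxB : x ∈ B
    · rw [indicator_of_mem hxB]; simp only [Pi.one_apply, one_mul]
      exact h1.trans le_self_add
    by_cases hyB : y ∈ B
    · rw [indicator_of_mem hyB]; simp only [Pi.one_apply, one_mul]
      exact h1.trans le_add_self
    · have hx1 : u x = 1 := by by_contra hc; exact hxB ⟨hx, hc⟩
      have hy1 : u y = 1 := by by_contra hc; exact hyB ⟨hy, hc⟩
      rw [hx1, hy1, sub_self, abs_zero, Real.zero_rpow (by linarith), zero_div]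
      simp
  have hind : Measurable (B.indicator (1 : Euc 2 → ℝ≥0∞)) := measurable_one.indicator hBm
  have hKy : ∀ x, Measurable (K x) := fun x => hKm.comp measurable_prodMk_left
  have hF : ∫⁻ x, ∫⁻ y, B.indicator 1 x * K x y ≤ ENNReal.ofReal (C * ε ^ (-a)) * volume B := by
    calc _ ≤ ∫⁻ x, ENNReal.ofReal (C * ε ^ (-a)) * B.indicator 1 x := by
          refine lintegral_mono fun x => ?_
          simp only
          rw [lintegral_const_mul _ (hKy x), mul_comm]
          gcongr
          rw [hKdef]; exact hK ε x hε
      _ = _ := by rw [lintegral_const_mul _ hind, lintegral_indicator_one hBm]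
  calc _ ≤ ∫⁻ x in G, ∫⁻ y in G, (B.indicator 1 x * K x y + B.indicator 1 y * K x y) :=
        setLIntegral_mono' hG fun x hx => setLIntegral_mono' hG fun y hy => hpt x hx y hy
    _ ≤ ∫⁻ x, ∫⁻ y, (B.indicator 1 x * K x y + B.indicator 1 y * K x y) :=
        (lintegral_mono fun x => lintegral_mono' Measure.restrict_le_self le_rfl).trans
          (lintegral_mono' Measure.restrict_le_self le_rfl)
    _ = (∫⁻ x, ∫⁻ y, B.indicator 1 x * K x y) + ∫⁻ x, ∫⁻ y, B.indicator 1 y * K x y := by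
        rw [← lintegral_add_left]
        · congr 1; ext x
          rw [lintegral_add_left ((hKy x).const_mul _)]
        · exact Measurable.lintegral_prod_right' (f := fun q : Euc 2 × Euc 2 =>
            B.indicator 1 q.1 * K q.1 q.2) ((hind.comp measurable_fst).mul hKm)
    _ = (∫⁻ x, ∫⁻ y, B.indicator 1 x * K x y) + ∫⁻ x, ∫⁻ y, B.indicator 1 x * K x y := by
        congr 1
        rw [lintegral_lintegral_swap]
        · simp_rw [hKsymm]
        · exact ((hind.comp measurable_snd).mul hKm).aemeasurable
    _ ≤ ENNReal.ofReal (C * ε ^ (-a)) * volume B + ENNReal.ofReal (C * ε ^ (-a)) * volume B :=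
        add_le_add hF hF
    _ = _ := by
        rw [← two_mul, ← mul_assoc, mul_assoc 2 C, ENNReal.ofReal_mul (by norm_num : (0 : ℝ) ≤ 2)]
        simp

theorem volume_setOf_abs_mem_Ioo_le {a t : ℝ} :
    volume {x : ℝ | a - t < |x| ∧ |x| < a} ≤ ENNReal.ofReal (2 * t) := by
  have hsub : {x : ℝ | a - t < |x| ∧ |x| < a} ⊆ Ioo (a - t) a ∪ Ioo (-a) (-(a - t)) := by
    rintro x ⟨h1, h2⟩
    rcases le_total 0 x with hx | hx
    · rw [abs_of_nonneg hx] at h1 h2; exact Or.inl ⟨h1, h2⟩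
    · rw [abs_of_nonpos hx] at h1 h2; exact Or.inr ⟨by linarith, by linarith⟩
  refine (measure_mono hsub).trans ((measure_union_le _ _).trans ?_)
  rw [Real.volume_Ioo, Real.volume_Ioo, ENNReal.ofReal_mul (by norm_num)]
  have e1 : a - (a - t) = t := by ring
  have e2 : -(a - t) - -a = t := by ring
  rw [e1, e2, ← two_mul]; simp

theorem volume_setOf_abs_lt (a : ℝ) : volume {x : ℝ | |x| < a} = ENNReal.ofReal (2 * a) := by
  have : {x : ℝ | |x| < a} = Ioo (-a) a := by ext x; simp [abs_lt]
  rw [this, Real.volume_Ioo]; congr 1; ring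

theorem measurableSet_setOf_abs_lt (a : ℝ) : MeasurableSet {x : ℝ | |x| < a} :=
  (isOpen_lt continuous_abs continuous_const).measurableSet

theorem measurableSet_setOf_abs_mem_Ioo (a b : ℝ) : MeasurableSet {x : ℝ | a < |x| ∧ |x| < b} :=
  ((isOpen_lt continuous_const continuous_abs).inter
    (isOpen_lt continuous_abs continuous_const)).measurableSet

theorem near_compl_toothed_subset {ν : ℕ → ℕ} (N : ℕ) {t : ℝ} {z w : Euc 2} (hz : z ∈ toothed ν (Iio N))
    (hw : w ∉ toothed ν (Iio N)) (hzw : dist z w < t) :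
    z ∈ {z : Euc 2 | z 0 ∈ {x : ℝ | 1 - t < |x| ∧ |x| < 1} ∧ z 1 ∈ {y : ℝ | |y| < 2}} ∪
      {z : Euc 2 | z 0 ∈ {x : ℝ | |x| < 1} ∧ z 1 ∈ {y : ℝ | 1 - t < |y| ∧ |y| < 1}} ∪
      ⋃ k ∈ Finset.range N,
        ({z : Euc 2 | z 0 ∈ {x : ℝ | |x| < 1} ∧ z 1 ∈ {y : ℝ | 2 - (1 / 2) ^ (k + 1) - t < |y| ∧
            |y| < 2 - (1 / 2) ^ (k + 1)}} ∪
          ({z : Euc 2 | z 0 ∈ Icc (-1) 1 ∩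
              comb (dyad ν k) (dyad ν k / 2 + dyad ν (k + 1)) t ∧ z 1 ∈ {y : ℝ | |y| < 2}} ∪
            {z : Euc 2 | z 0 ∈ Icc (-1) 1 ∩
              comb (dyad ν k) (dyad ν k / 2 - dyad ν (k + 1)) t ∧ z 1 ∈ {y : ℝ | |y| < 2}})) := by
  have hz2 := (toothed_subset _ _ hz).2
  obtain ⟨hz0, hz1⟩ := hz
  have d0 := (abs_coord_sub_le_dist z w 0).trans_lt hzw
  have d1 := (abs_coord_sub_le_dist z w 1).trans_lt hzw
  have a0 := abs_sub_abs_le_abs_sub (w 0) (z 0)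
  have a1 := abs_sub_abs_le_abs_sub (w 1) (z 1)
  rw [abs_sub_comm] at a0 a1
  rcases le_or_gt 1 |w 0| with hw0 | hw0
  · exact Or.inl (Or.inl ⟨⟨by linarith, hz0⟩, hz2⟩)
  have hwn : ¬ (|w 1| < 1 ∨ ∃ k ∈ Iio N, w 0 ∈ slit ν k ∧ |w 1| < 2 - (1 / 2) ^ (k + 1)) :=
    fun h => hw ⟨hw0, h⟩
  push Not at hwn
  obtain ⟨hw1, hw2⟩ := hwn
  rcases lt_or_ge |z 1| 1 with h | h
  · exact Or.inl (Or.inr ⟨hz0, by linarith, h⟩)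
  obtain ⟨k, hkN, hk, hk1⟩ := hz1.resolve_left (not_lt.2 h)
  refine Or.inr ?_
  simp only [mem_iUnion, Finset.mem_range]
  refine ⟨k, hkN, ?_⟩
  by_cases hwk : w 0 ∈ slit ν k
  · have := hw2 k hkN hwk
    exact Or.inl ⟨hz0, by linarith, hk1⟩
  · obtain ⟨m, hm⟩ := hk
    have hwm : dyad ν (k + 1) ≤ |w 0 - (m * dyad ν k + dyad ν k / 2)| := by
      by_contra hc; exact hwk ⟨m, not_le.1 hc⟩
    have hz0' := abs_le.1 hz0.le
    rw [abs_lt] at hm d0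
    rcases le_abs'.1 hwm with h3 | h3
    · refine Or.inr (Or.inr ⟨⟨hz0', m, ?_⟩, hz2⟩)
      rw [abs_lt]; constructor <;> linarith [hm.1, hm.2, d0.1, d0.2]
    · refine Or.inr (Or.inl ⟨⟨hz0', m, ?_⟩, hz2⟩)
      rw [abs_lt]; constructor <;> linarith [hm.1, hm.2, d0.1, d0.2]

theorem volume_near_compl_toothed_le {ν : ℕ → ℕ} (hν : ∀ k, 2 * ν k + k + 8 ≤ ν (k + 1))
    (N : ℕ) {t : ℝ} (ht0 : 0 < t) (ht1 : t ≤ 1) :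
    volume {z ∈ toothed ν (Iio N) | ∃ w, w ∉ toothed ν (Iio N) ∧ dist z w < t} ≤
      ENNReal.ofReal (96 * (N + 1) * 2 ^ ν N * t) := by
  have hcomb : ∀ k < N, ∀ e, volume {z : Euc 2 | z 0 ∈ Icc (-1) 1 ∩ comb (dyad ν k) e t ∧
      z 1 ∈ {y : ℝ | |y| < 2}} ≤ ENNReal.ofReal (40 * 2 ^ ν N * t) := fun k hk e => by
    rw [volume_rectangle (measurableSet_Icc.inter (isOpen_comb _ _ _).measurableSet)
      (measurableSet_setOf_abs_lt 2), volume_setOf_abs_lt]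
    refine (mul_le_mul' (volume_Icc_inter_comb_le (by norm_num) (dyad_pos ν k) ht0.le)
      le_rfl).trans ?_
    have hd := dyad_pos ν k
    have hinv : (dyad ν k)⁻¹ ≤ 2 ^ ν N := by
      unfold dyad
      rw [one_div, inv_pow, inv_inv]
      exact pow_le_pow_right₀ (by norm_num) (monotone_of_growth hν hk.le)
    have h1 : (1 : ℝ) ≤ 2 ^ ν N := one_le_pow₀ (by norm_num)
    rw [← ENNReal.ofReal_mul (by have := div_nonneg (by linarith : (0 : ℝ) ≤ 1 - -1 + 2 * t) hd.le
                                 positivity)]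
    apply ENNReal.ofReal_le_ofReal
    have h2 : (1 - -1 + 2 * t) / dyad ν k ≤ 4 * 2 ^ ν N := by
      rw [div_eq_mul_inv]; gcongr; linarith
    nlinarith
  have hr1 : volume {z : Euc 2 | z 0 ∈ {x : ℝ | 1 - t < |x| ∧ |x| < 1} ∧ z 1 ∈ {y : ℝ | |y| < 2}} ≤
      ENNReal.ofReal (8 * t) := by
    rw [volume_rectangle (measurableSet_setOf_abs_mem_Ioo _ _) (measurableSet_setOf_abs_lt 2),
      volume_setOf_abs_lt]
    refine (mul_le_mul' volume_setOf_abs_mem_Ioo_le le_rfl).trans ?_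
    rw [← ENNReal.ofReal_mul (by positivity)]
    apply ENNReal.ofReal_le_ofReal; linarith
  have hr2 : ∀ a, volume {z : Euc 2 | z 0 ∈ {x : ℝ | |x| < 1} ∧
      z 1 ∈ {y : ℝ | a - t < |y| ∧ |y| < a}} ≤ ENNReal.ofReal (4 * t) := fun a => by
    rw [volume_rectangle (measurableSet_setOf_abs_lt 1) (measurableSet_setOf_abs_mem_Ioo _ _),
      volume_setOf_abs_lt]
    refine (mul_le_mul' le_rfl volume_setOf_abs_mem_Ioo_le).trans ?_
    rw [← ENNReal.ofReal_mul (by positivity)]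
    apply ENNReal.ofReal_le_ofReal; linarith
  have h1 : (1 : ℝ) ≤ 2 ^ ν N := one_le_pow₀ (by norm_num)
  have hsub : {z ∈ toothed ν (Iio N) | ∃ w, w ∉ toothed ν (Iio N) ∧ dist z w < t} ⊆ _ :=
    fun z hz => near_compl_toothed_subset N hz.1 hz.2.choose_spec.1 hz.2.choose_spec.2
  refine (measure_mono hsub).trans ?_
  refine (measure_union_le _ _).trans ((add_le_add ((measure_union_le _ _).trans
    (add_le_add hr1 (hr2 1))) ((measure_biUnion_finset_le _ _).trans
    (Finset.sum_le_card_nsmul _ _ (ENNReal.ofReal (4 * t) + (ENNReal.ofReal (40 * 2 ^ ν N * t) +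
      ENNReal.ofReal (40 * 2 ^ ν N * t))) fun k hk => ?_))).trans ?_)
  · rw [Finset.mem_range] at hk
    exact (measure_union_le _ _).trans (add_le_add (hr2 _) ((measure_union_le _ _).trans
      (add_le_add (hcomb k hk _) (hcomb k hk _))))
  · rw [Finset.card_range, nsmul_eq_mul, ← ENNReal.ofReal_add (by positivity) (by positivity),
      ← ENNReal.ofReal_add (by positivity) (by positivity),
      ← ENNReal.ofReal_add (by positivity) (by positivity), ← ENNReal.ofReal_natCast,
      ← ENNReal.ofReal_mul (by positivity), ← ENNReal.ofReal_add (by positivity) (by positivity)]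
    apply ENNReal.ofReal_le_ofReal
    have hN : (0 : ℝ) ≤ N := by positivity
    have h3 : t ≤ 2 ^ ν N * t := by nlinarith
    have h4 : N * t ≤ N * (2 ^ ν N * t) := by gcongr
    nlinarith

theorem volume_toothed_diff_le {ν : ℕ → ℕ} (hν : ∀ k, 2 * ν k + k + 8 ≤ ν (k + 1)) (N : ℕ) :
    volume (toothed ν univ \ toothed ν (Iio N)) ≤
      ENNReal.ofReal (288 * (1 / 2) ^ (ν (N + 1) - ν N)) := by
  have hsub : toothed ν univ \ toothed ν (Iio N) ⊆
      {z : Euc 2 | z 0 ∈ Icc (-1) (-1 + 2) ∩ ⋃ k, ⋃ (_ : N ≤ k), slit ν k ∧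
        z 1 ∈ {y : ℝ | |y| < 2}} := by
    rintro z ⟨hz, hzN⟩
    have hz2 := (toothed_subset _ _ hz).2
    obtain ⟨hz0, hz1⟩ := hz
    have hz0' := abs_le.1 hz0.le
    obtain ⟨k, -, hk, hk1⟩ := hz1.resolve_left fun h => hzN ⟨hz0, Or.inl h⟩
    refine ⟨⟨⟨hz0'.1, by linarith [hz0'.2]⟩, ?_⟩, hz2⟩
    simp only [mem_iUnion]
    refine ⟨k, ?_, hk⟩
    by_contra hc
    exact hzN ⟨hz0, Or.inr ⟨k, not_le.1 hc, hk, hk1⟩⟩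
  refine (measure_mono hsub).trans ?_
  rw [volume_rectangle (measurableSet_Icc.inter (isOpen_iUnion fun k => isOpen_iUnion fun _ =>
    isOpen_slit ν k).measurableSet) (measurableSet_setOf_abs_lt 2), volume_setOf_abs_lt]
  have hd : dyad ν N ≤ 4 * 2 := (dyad_le hν N).trans
    ((pow_le_one₀ (by norm_num) (by norm_num)).trans (by norm_num))
  refine (mul_le_mul' (volume_Icc_inter_iUnion_slit_le hν hd) le_rfl).trans ?_
  rw [← ENNReal.ofReal_mul (by positivity)]
  apply ENNReal.ofReal_le_ofReal
  apply le_of_eq; ring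

/-- The transition layer of a cutoff at scale `ε` of the level-`N` approximation is small. -/
theorem volume_layer_le {ν : ℕ → ℕ} (hν : ∀ k, 2 * ν k + k + 8 ≤ ν (k + 1))
    (N : ℕ) {ε : ℝ} (hε0 : 0 < ε) (hε1 : ε ≤ 1 / 4)
    (hδ : 576 * (1 / 2) ^ (ν (N + 1) - ν N) ≤ ε) {u : Euc 2 → ℝ}
    (hu : ∀ z, 4 * ε ≤ infDist z (crossToothed ν (Iio N))ᶜ → u z = 1) :
    volume {z ∈ crossToothed ν univ | u z ≠ 1} ≤
      ENNReal.ofReal ((768 * (N + 1) * 2 ^ ν N + 1) * ε) := by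
  set T := {z ∈ toothed ν (Iio N) | ∃ w, w ∉ toothed ν (Iio N) ∧ dist z w < 4 * ε} with hT
  set D := toothed ν univ \ toothed ν (Iio N) with hD
  have hG := compl_crossToothed_nonempty ν (Iio N)
  have hT' : ∀ z ∈ toothed ν univ, u z ≠ 1 → z ∈ T ∪ D := by
    intro z hz huz
    by_cases hzN : z ∈ toothed ν (Iio N)
    · have h1 : infDist z (crossToothed ν (Iio N))ᶜ < 4 * ε := by
        by_contra hc; exact huz (hu z (not_lt.1 hc))
      obtain ⟨w, hw, hzw⟩ := (infDist_lt_iff hG).1 h1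
      exact Or.inl ⟨hzN, w, fun h => hw (Or.inl h), hzw⟩
    · exact Or.inr ⟨hz, hzN⟩
  have hT'' : ∀ z, swapEuc z ∈ toothed ν univ → u z ≠ 1 → swapEuc z ∈ T ∪ D := by
    intro z hz huz
    by_cases hzN : swapEuc z ∈ toothed ν (Iio N)
    · have h1 : infDist z (crossToothed ν (Iio N))ᶜ < 4 * ε := by
        by_contra hc; exact huz (hu z (not_lt.1 hc))
      obtain ⟨w, hw, hzw⟩ := (infDist_lt_iff hG).1 h1
      exact Or.inl ⟨hzN, swapEuc w, fun h => hw (Or.inr h), by rwa [swapEuc.dist_map]⟩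
    · exact Or.inr ⟨hz, hzN⟩
  have hsub : {z ∈ crossToothed ν univ | u z ≠ 1} ⊆ (T ∪ D) ∪ swapEuc ⁻¹' (T ∪ D) := by
    rintro z ⟨hz | hz, huz⟩
    · exact Or.inl (hT' z hz huz)
    · exact Or.inr (hT'' z hz huz)
  have hTD : volume (T ∪ D) ≤ ENNReal.ofReal ((384 * (N + 1) * 2 ^ ν N + 1 / 2) * ε) := by
    refine (measure_union_le _ _).trans ((add_le_add (volume_near_compl_toothed_le hν N
      (by positivity) (by linarith)) (volume_toothed_diff_le hν N)).trans ?_)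
    rw [← ENNReal.ofReal_add (by positivity) (by positivity)]
    apply ENNReal.ofReal_le_ofReal
    linarith
  refine (measure_mono hsub).trans ((measure_union_le _ _).trans ?_)
  have hsw : volume (swapEuc ⁻¹' (T ∪ D)) = volume (T ∪ D) :=
    swapEuc.measurePreserving.measure_preimage_equiv (f := swapEuc.toMeasurableEquiv) (T ∪ D)
  rw [hsw]
  refine (add_le_add hTD hTD).trans ?_
  rw [← ENNReal.ofReal_add (by positivity) (by positivity)]
  apply ENNReal.ofReal_le_ofReal
  apply le_of_eq; ring

theorem zero_mem_slitCompl {ν : ℕ → ℕ} (hν : ∀ k, 2 * ν k + k + 8 ≤ ν (k + 1))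
    : (0 : ℝ) ∈ slitCompl ν 0 := by
  refine ⟨by simp, fun k _ hk => ?_⟩
  have h := abs_lt.1 (abs_sub_lt_of_mem_slit hν (m := 0) (by simp)
    (by simpa using (dyad_pos ν k).le) hk)
  have := dyad_succ_le hν k
  have := dyad_pos ν k
  norm_num at h
  linarith [h.1]

theorem le_lintegral_div_infDist {ν : ℕ → ℕ} (hν : ∀ k, 2 * ν k + k + 8 ≤ ν (k + 1))
    {M : ℕ} {p a : ℝ} (N : ℕ) (ha0 : 0 < a) (ha1 : a ≤ 1)
    {u : Euc 2 → ℝ}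
    (hu : ∀ z, 4 * (1 / 2 : ℝ) ^ (M + 3) ≤ infDist z (crossToothed ν (Iio N))ᶜ → u z = 1) :
    ENNReal.ofReal (M / 32 * ((1 / 2 : ℝ) ^ M) ^ (1 - a)) ≤
      ∫⁻ z in crossToothed ν univ,
        ENNReal.ofReal (|u z| ^ p / infDist z (frontier (crossToothed ν univ)) ^ a) := by
  set G := crossToothed ν univ with hG
  set A := slitCompl ν 0 ∩ Icc (0 - 1 / 2) (0 + 1 / 2) with hA
  have hAm : MeasurableSet A := (isClosed_slitCompl ν 0).measurableSet.inter measurableSet_Icc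
  have hAv : ENNReal.ofReal (1 / 16) ≤ volume A := by
    have := le_volume_slitCompl_inter hν (x := 0) (ρ := 1 / 2) (i := 0) (by simp) (by norm_num)
      (by norm_num) (Or.inr (zero_mem_slitCompl hν))
    norm_num at this ⊢
    simpa [hA] using this
  set I : ℕ → Set ℝ := fun m => Ico (1 - (1 / 2) ^ m) (1 - (1 / 2) ^ (m + 1)) with hI
  set R : ℕ → Set (Euc 2) := fun m => {z | z 0 ∈ A ∧ z 1 ∈ I m} with hR
  have hRm : ∀ m, MeasurableSet (R m) := fun m =>
    (hAm.preimage (by fun_prop : Measurable fun z : Euc 2 => z 0)).inter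
      (measurableSet_Ico.preimage (by fun_prop : Measurable fun z : Euc 2 => z 1))
  have hpow : ∀ {m n : ℕ}, m ≤ n → (1 / 2 : ℝ) ^ n ≤ (1 / 2) ^ m := fun h =>
    pow_le_pow_of_le_one (by norm_num) (by norm_num) h
  have hRd : Pairwise (Function.onFun Disjoint R) := by
    have : ∀ m n, m < n → Disjoint (R m) (R n) := fun m n hmn => by
      rw [Set.disjoint_left]
      rintro z ⟨-, -, h1⟩ ⟨-, h2, -⟩
      linarith [hpow (m := m + 1) (n := n) hmn]
    intro m n hmn
    rcases lt_or_gt_of_ne hmn with h | h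
    · exact this m n h
    · exact (this n m h).symm
  have hpt : ∀ m < M, ∀ z ∈ R m, z ∈ G ∧ u z = 1 ∧ infDist z (frontier G) ≤ (1 / 2) ^ m := by
    rintro m hm z ⟨⟨hz0, hz0'⟩, hz1, hz1'⟩
    have p1 : (1 / 2 : ℝ) ^ M ≤ (1 / 2) ^ (m + 1) := hpow hm
    have p2 : (1 / 2 : ℝ) ^ m ≤ 1 := pow_le_one₀ (by norm_num) (by norm_num)
    have p3 : (0 : ℝ) < (1 / 2) ^ M := by positivity
    have hsq : ∀ w : Euc 2, |w 0| < 1 → |w 1| < 1 → ∀ S, w ∈ crossToothed ν S := fun w h1 h2 S =>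
      Or.inl (square_subset_toothed ν S ⟨h1, h2⟩)
    have hz0a : |z 0| ≤ 1 / 2 := abs_le.2 ⟨by linarith [hz0'.1], by linarith [hz0'.2]⟩
    refine ⟨hsq z (by linarith) (abs_lt.2 ⟨by linarith, by linarith⟩) _, hu z ?_, ?_⟩
    · refine (le_infDist (compl_crossToothed_nonempty ν _)).2 fun w hw => ?_
      by_contra hc
      rw [not_le] at hc
      have e : 4 * (1 / 2 : ℝ) ^ (M + 3) = (1 / 2) ^ M / 2 := by rw [pow_add]; norm_num; ring
      rw [e] at hc
      have d0 := abs_lt.1 ((abs_coord_sub_le_dist z w 0).trans_lt hc)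
      have d1 := abs_lt.1 ((abs_coord_sub_le_dist z w 1).trans_lt hc)
      have p4 : (1 / 2 : ℝ) ^ M ≤ 1 := pow_le_one₀ (by norm_num) (by norm_num)
      rw [abs_le] at hz0a
      exact hw (hsq w (abs_lt.2 ⟨by linarith [d0.2], by linarith [d0.1]⟩)
        (abs_lt.2 ⟨by linarith [d1.2], by linarith [d1.1]⟩) _)
    · have hf : (!₂[z 0, 1] : Euc 2) ∈ frontier G := by
        rw [hG, frontier_crossToothed hν]
        refine Or.inl ⟨?_, ?_, ?_, fun k hk => absurd hk (hz0.2 k (Nat.zero_le k))⟩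
        · simp only [Matrix.cons_val_zero]; linarith
        · simp
        · simp
      refine (infDist_le_dist_of_mem hf).trans ?_
      rw [EuclideanSpace.dist_eq, Fin.sum_univ_two]
      simp only [Matrix.cons_val_zero, Matrix.cons_val_one, Matrix.cons_val_fin_one, dist_self]
      rw [zero_pow two_ne_zero, zero_add, Real.sqrt_sq dist_nonneg, Real.dist_eq, abs_le]
      constructor <;> linarith
  have hfr : (frontier G).Nonempty := by
    rw [hG, frontier_crossToothed hν]
    refine ⟨!₂[0, 1], Or.inl ⟨?_, ?_, ?_, fun k hk =>
      absurd hk ((zero_mem_slitCompl hν).2 k (Nat.zero_le k))⟩⟩ <;> simp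
  have hterm : ∀ m < M, ENNReal.ofReal (1 / 32 * ((1 / 2 : ℝ) ^ M) ^ (1 - a)) ≤
      ∫⁻ z in R m, ENNReal.ofReal (|u z| ^ p / infDist z (frontier G) ^ a) := by
    intro m hm
    have hm0 : (0 : ℝ) < (1 / 2) ^ m := by positivity
    calc _ ≤ ENNReal.ofReal (((1 / 2 : ℝ) ^ m) ^ (-a)) * ENNReal.ofReal (1 / 16 * (1 / 2) ^ (m + 1)) := by
          rw [← ENNReal.ofReal_mul (by positivity)]
          apply ENNReal.ofReal_le_ofReal
          have h1 : ((1 / 2 : ℝ) ^ M) ^ (1 - a) ≤ ((1 / 2 : ℝ) ^ m) ^ (1 - a) :=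
            Real.rpow_le_rpow (by positivity) (hpow hm.le) (by linarith)
          have h2 : ((1 / 2 : ℝ) ^ m) ^ (1 - a) = ((1 / 2 : ℝ) ^ m) ^ (-a) * (1 / 2) ^ m := by
            rw [sub_eq_neg_add, Real.rpow_add_one hm0.ne']
          rw [pow_succ]
          linarith
      _ ≤ ENNReal.ofReal (((1 / 2 : ℝ) ^ m) ^ (-a)) * volume (R m) := by
          gcongr
          rw [hR, volume_rectangle hAm measurableSet_Ico, Real.volume_Ico,
            ENNReal.ofReal_mul (by norm_num)]
          refine mul_le_mul' hAv (ENNReal.ofReal_le_ofReal ?_)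
          rw [pow_succ]; linarith
      _ = ∫⁻ z in R m, ENNReal.ofReal (((1 / 2 : ℝ) ^ m) ^ (-a)) := by
          rw [setLIntegral_const]
      _ ≤ _ := by
          refine setLIntegral_mono' (hRm m) fun z hz => ?_
          obtain ⟨hzG, huz, hd⟩ := hpt m hm z hz
          apply ENNReal.ofReal_le_ofReal
          have hzf : z ∉ frontier G := fun h =>
            ((isOpen_crossToothed ν univ).frontier_eq ▸ h : z ∈ closure G \ G).2 hzG
          have hpos : 0 < infDist z (frontier G) :=
            (isClosed_frontier.notMem_iff_infDist_pos hfr).1 hzf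
          have hinv : 1 / infDist z (frontier G) ^ a = infDist z (frontier G) ^ (-a) := by
            rw [Real.rpow_neg hpos.le, one_div]
          rw [huz, abs_one, Real.one_rpow, hinv]
          exact Real.rpow_le_rpow_of_nonpos hpos hd (by linarith)
  calc ENNReal.ofReal (M / 32 * ((1 / 2 : ℝ) ^ M) ^ (1 - a))
      = ∑ m ∈ Finset.range M, ENNReal.ofReal (1 / 32 * ((1 / 2 : ℝ) ^ M) ^ (1 - a)) := by
        rw [Finset.sum_const, Finset.card_range, nsmul_eq_mul, ← ENNReal.ofReal_natCast,
          ← ENNReal.ofReal_mul (by positivity)]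
        congr 1; ring
    _ ≤ ∑ m ∈ Finset.range M,
          ∫⁻ z in R m, ENNReal.ofReal (|u z| ^ p / infDist z (frontier G) ^ a) :=
        Finset.sum_le_sum fun m hm => hterm m (Finset.mem_range.1 hm)
    _ = ∫⁻ z in ⋃ m ∈ Finset.range M, R m,
          ENNReal.ofReal (|u z| ^ p / infDist z (frontier G) ^ a) :=
        (lintegral_biUnion_finset (fun m _ n _ h => hRd h) (fun m _ => hRm m) _).symm
    _ ≤ _ := by
        refine lintegral_mono_set fun z hz => ?_
        simp only [mem_iUnion, Finset.mem_range] at hz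
        obtain ⟨m, hm, hz⟩ := hz
        exact (hpt m hm z hz).1

/-- Number of dyadic layers used to test the Hardy inequality at stage `k`, if `ν k = n`. -/
def layerCount (k n : ℕ) : ℕ := (k + 1) * (768 * (k + 1) * 2 ^ n + 1)

/-- A rapidly increasing sequence of exponents. -/
def exponentSeq : ℕ → ℕ
  | 0 => 0
  | k + 1 => 2 * exponentSeq k + k + 13 + layerCount k (exponentSeq k)

theorem exponentSeq_growth (k : ℕ) : 2 * exponentSeq k + k + 8 ≤ exponentSeq (k + 1) := by
  rw [exponentSeq]; omega

theorem not_admitsHardy_crossToothed {s p : ℝ} (hp1 : 1 < p)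
    (hsp0 : 0 < s * p) (hsp1 : s * p ≤ 1) :
    ¬ AdmitsHardy 2 s p (crossToothed exponentSeq univ) := by
  rintro ⟨c, hc, hH⟩
  set ν := exponentSeq
  have hν : ∀ k, 2 * ν k + k + 8 ≤ ν (k + 1) := exponentSeq_growth
  set a := s * p with ha
  obtain ⟨C, hC, hE⟩ := exists_gagliardo_le (p := p) (a := a) hsp0 (by linarith)
  obtain ⟨N, hN⟩ := exists_nat_gt (32 * c * C)
  set M := layerCount N (ν N) with hM
  set ε : ℝ := (1 / 2) ^ (M + 3) with hε
  have hε0 : 0 < ε := by positivity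
  have hε1 : ε ≤ 1 / 4 := by
    have : (1 / 2 : ℝ) ^ M ≤ 1 := pow_le_one₀ (by norm_num) (by norm_num)
    rw [hε, pow_add]; norm_num at this ⊢; linarith
  have hδ : 576 * (1 / 2 : ℝ) ^ (ν (N + 1) - ν N) ≤ ε := by
    have h1 : (1 / 2 : ℝ) ^ (ν (N + 1) - ν N) ≤ (1 / 2) ^ (M + 3 + 10) := by
      apply pow_le_pow_of_le_one (by norm_num) (by norm_num)
      have : ν (N + 1) = 2 * ν N + N + 13 + M := by simp only [ν]; rw [exponentSeq]
      omega
    rw [pow_add _ (M + 3), ← hε] at h1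
    norm_num at h1 ⊢; linarith
  obtain ⟨u, hu1, hu2, hu3, hu4, hu5⟩ := exists_smooth_cutoff
    (isBounded_ball.subset (crossToothed_subset_ball ν (Iio N))) hε0
  have hL := le_lintegral_div_infDist hν (p := p) N hsp0 hsp1 (M := M) hu5
  have h1 := hH u hu1 hu2 (hu3.trans (crossToothed_mono ν (subset_univ _)))
  have h2 := hE ε (crossToothed ν univ) u hε0 (isOpen_crossToothed ν univ).measurableSet
    hu1.continuous hu4
  have h3 := volume_layer_le hν N hε0 hε1 hδ hu5
  have h4 : ENNReal.ofReal (M / 32 * ((1 / 2 : ℝ) ^ M) ^ (1 - a)) ≤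
      ENNReal.ofReal (c * (C * ε ^ (-a) * ((768 * (N + 1) * 2 ^ ν N + 1) * ε))) := by
    refine hL.trans (h1.trans ?_)
    rw [ENNReal.ofReal_mul hc.le, ENNReal.ofReal_mul (by positivity)]
    rw [Nat.cast_ofNat]
    gcongr
    exact h2.trans (by gcongr)
  rw [ENNReal.ofReal_le_ofReal_iff (by positivity)] at h4
  set q : ℝ := (1 / 2 : ℝ) ^ M
  have hq0 : 0 < q ^ (1 - a) := by positivity
  have h5 : ε ^ (-a) * ε ≤ q ^ (1 - a) := by
    rw [← Real.rpow_add_one hε0.ne', neg_add_eq_sub]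
    exact Real.rpow_le_rpow hε0.le (pow_le_pow_of_le_one (by norm_num) (by norm_num) (by omega))
      (by linarith)
  set L : ℝ := 768 * (N + 1) * 2 ^ ν N + 1
  have hL0 : 0 < L := by positivity
  have hML : (M : ℝ) = (N + 1) * L := by
    rw [hM, layerCount]; push_cast; rfl
  have h6 : c * (C * ε ^ (-a) * (L * ε)) ≤ c * C * L * q ^ (1 - a) := by
    calc _ = c * C * L * (ε ^ (-a) * ε) := by ring
      _ ≤ _ := by gcongr
  have h7 := h4.trans h6
  have h8 := le_of_mul_le_mul_right h7 hq0
  rw [hML] at h8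
  have h9 : (N + 1 : ℝ) / 32 ≤ c * C := by
    refine le_of_mul_le_mul_right ?_ hL0
    linarith
  linarith

/-- For `1<p<∞`, `0<s<1` with `0<sp≤1`, there is a bounded domain `G' ⊆ ℝ²`
with locally `(s,p)`-uniformly fat boundary which does not admit the `(s,p)`-Hardy
inequality. -/
theorem statement13 (s p : ℝ) (hp1 : 1 < p) (hs0 : 0 < s) (hs1 : s < 1)
    (hsp0 : 0 < s * p) (hsp1 : s * p ≤ 1) :
    ∃ G' : Set (Euc 2), IsOpen G' ∧ IsConnected G' ∧ Bornology.IsBounded G' ∧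
      LocallyUniformlyFat 2 s p (frontier G') ∧ ¬ AdmitsHardy 2 s p G' :=
  ⟨crossToothed exponentSeq univ, isOpen_crossToothed _ _, isConnected_crossToothed _ _,
    isBounded_ball.subset (crossToothed_subset_ball _ _),
    locallyUniformlyFat_frontier_crossToothed exponentSeq_growth hp1 hs0 (by linarith)
      (by linarith),
    not_admitsHardy_crossToothed hp1 hsp0 hsp1⟩

end
end

section
/- Let 1<p<∞ and 0<s<1 be such that sp=1. Then the open upper half-plane H = {(x₁,x₂) ∈ ℝ² : x₂ > 0} does not admit the (s,p)-Hardy inequality; that is, there is no constant c>0 such that ∫_H |u(x)|^p dist(x,∂H)^{-sp} dx ≤ c ∫_H ∫_H |u(x)-u(y)|^p |x-y|^{-(2+sp)} dy dx for every u ∈ C_c^∞(H). -/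
open MeasureTheory Metric Set
open scoped ENNReal NNReal Topology

noncomputable section

/-- The truncated singular kernel `min(1, a|z|)^p |z|^{-3}` on the plane. -/
def truncKernel (p a : ℝ) (z : Euc 2) : ℝ≥0∞ :=
  ENNReal.ofReal (min 1 (a * ‖z‖) ^ p / ‖z‖ ^ (3 : ℝ))

@[fun_prop]
lemma measurable_truncKernel (p a : ℝ) : Measurable (truncKernel p a) := by
  unfold truncKernel
  fun_prop

lemma lintegral_truncKernel_one_lt_top {p : ℝ} (hp : 1 < p) :
    ∫⁻ z, truncKernel p 1 z < ∞ := by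
  have h : Integrable (fun z : Euc 2 ↦ min 1 ‖z‖ ^ p / ‖z‖ ^ (3 : ℝ)) := by
    rw [integrable_fun_norm_addHaar volume (f := fun r : ℝ ↦ min 1 r ^ p / r ^ (3 : ℝ)),
      finrank_euclideanSpace_fin, ← Ioc_union_Ioi_eq_Ioi (zero_le_one (α := ℝ))]
    refine IntegrableOn.union ?_ ?_
    · have h1 : IntegrableOn (fun r : ℝ ↦ r ^ (p - 2)) (Ioc 0 1) :=
        (intervalIntegrable_iff_integrableOn_Ioc_of_le zero_le_one).1
          (intervalIntegral.intervalIntegrable_rpow' (by linarith))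
      refine h1.congr_fun (fun r hr ↦ ?_) measurableSet_Ioc
      have hr0 : 0 < r := hr.1
      simp only [min_eq_right hr.2, smul_eq_mul]
      rw [← Real.rpow_sub hr0, ← Real.rpow_natCast, ← Real.rpow_add hr0]
      congr 1
      norm_num
      ring
    · refine (integrableOn_Ioi_rpow_of_lt (a := -2) (by norm_num) zero_lt_one).congr_fun
        (fun r hr ↦ ?_) measurableSet_Ioi
      have hr1 : 1 < r := hr
      have hr0 : 0 < r := by linarith
      simp only [min_eq_left hr1.le, smul_eq_mul, Real.one_rpow]
      rw [one_div, ← Real.rpow_neg hr0.le, ← Real.rpow_natCast, ← Real.rpow_add hr0]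
      norm_num
  simpa [truncKernel] using h.lintegral_lt_top

lemma lintegral_truncKernel {p a : ℝ} (ha : 0 < a) :
    ∫⁻ z, truncKernel p a z = ENNReal.ofReal a * ∫⁻ z, truncKernel p 1 z := by
  have hk (z : Euc 2) : truncKernel p a z = ENNReal.ofReal (a ^ 3) * truncKernel p 1 (a • z) := by
    unfold truncKernel
    rw [← ENNReal.ofReal_mul (by positivity), norm_smul, Real.norm_of_nonneg ha.le, one_mul,
      Real.mul_rpow ha.le (norm_nonneg z)]
    congr 1
    have : a ^ (3 : ℝ) = a ^ 3 := by exact_mod_cast Real.rpow_natCast a 3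
    rw [this, ← mul_div_assoc, mul_div_mul_left _ _ (by positivity)]
  have hs : ∫⁻ z, truncKernel p 1 (a • z)
      = ENNReal.ofReal (a ^ 2)⁻¹ * ∫⁻ z, truncKernel p 1 z := by
    rw [← lintegral_map (measurable_truncKernel p 1) (measurable_const_smul a),
      Measure.map_addHaar_smul _ ha.ne', lintegral_smul_measure, finrank_euclideanSpace_fin,
      abs_of_pos (by positivity), smul_eq_mul]
  simp_rw [hk]
  rw [lintegral_const_mul _ (by fun_prop), hs, ← mul_assoc, ← ENNReal.ofReal_mul (by positivity)]
  congr 2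
  field_simp

lemma lintegral_lintegral_indicator_add_mul_sub {A : Set (Euc 2)} (hA : MeasurableSet A)
    {k : Euc 2 → ℝ≥0∞} (hk : Measurable k) :
    ∫⁻ x, ∫⁻ y, (A.indicator 1 x + A.indicator 1 y) * k (x - y)
      = 2 * (volume A * ∫⁻ z, k z) := by
  have hA1 : Measurable (A.indicator (1 : Euc 2 → ℝ≥0∞)) := measurable_one.indicator hA
  have h1 : ∫⁻ x, ∫⁻ y, A.indicator 1 x * k (x - y) = volume A * ∫⁻ z, k z := by
    have (x : Euc 2) : ∫⁻ y, A.indicator 1 x * k (x - y) = A.indicator 1 x * ∫⁻ z, k z := by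
      rw [lintegral_const_mul _ (by fun_prop), lintegral_sub_left_eq_self k x]
    simp_rw [this]
    rw [lintegral_mul_const _ hA1, lintegral_indicator_one hA]
  have h2 : ∫⁻ x, ∫⁻ y, A.indicator 1 y * k (x - y) = volume A * ∫⁻ z, k z := by
    rw [lintegral_lintegral_swap (by fun_prop)]
    have (y : Euc 2) : ∫⁻ x, A.indicator 1 y * k (x - y) = A.indicator 1 y * ∫⁻ z, k z := by
      rw [lintegral_const_mul _ (by fun_prop), lintegral_sub_right_eq_self k y]
    simp_rw [this]
    rw [lintegral_mul_const _ hA1, lintegral_indicator_one hA]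
  simp_rw [add_mul]
  rw [two_mul, ← congrArg₂ (· + ·) h1 h2, ← lintegral_add_left (by fun_prop)]
  refine lintegral_congr fun x ↦ ?_
  rw [lintegral_add_left (by fun_prop)]

lemma ofReal_rpow_div_dist_le {p L a : ℝ} (hp : 0 < p) {x y : Euc 2} {S : Set (Euc 2)}
    (ha0 : 0 ≤ a) (ha1 : a ≤ 1) (haL : a ≤ L * dist x y) (haS : x ∉ S → y ∉ S → a = 0) :
    ENNReal.ofReal (a ^ p / dist x y ^ (3 : ℝ))
      ≤ (S.indicator 1 x + S.indicator 1 y) * truncKernel p L (x - y) := by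
  by_cases h : x ∈ S ∨ y ∈ S
  · have h1 : (1 : ℝ≥0∞) ≤ S.indicator 1 x + S.indicator 1 y := by
      rcases h with h | h <;> simp [h]
    refine le_trans ?_ (le_mul_of_one_le_left zero_le h1)
    rw [truncKernel, ← dist_eq_norm]
    gcongr
    exact le_min ha1 haL
  · push Not at h
    simp [haS h.1 h.2, Real.zero_rpow hp.ne']

lemma abs_mul_sub_mul_le_add_min {a b c d : ℝ} (ha : 0 ≤ a) (hb : 0 ≤ b)
    (hc : c ∈ Icc (0 : ℝ) 1) (hd : d ∈ Icc (0 : ℝ) 1) :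
    |a * c - b * d| ≤ |a - b| + min a b * |c - d| := by
  rcases le_total a b with h | h
  · rw [min_eq_left h]
    calc |a * c - b * d| = |(a - b) * d + a * (c - d)| := by ring_nf
      _ ≤ |a - b| * |d| + |a| * |c - d| := by
        rw [← abs_mul, ← abs_mul]; exact abs_add_le _ _
      _ ≤ |a - b| + a * |c - d| := by
        rw [abs_of_nonneg ha, abs_of_nonneg hd.1]
        gcongr
        exact mul_le_of_le_one_right (abs_nonneg _) hd.2
  · rw [min_eq_right h]
    calc |a * c - b * d| = |(a - b) * c + b * (c - d)| := by ring_nf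
      _ ≤ |a - b| * |c| + |b| * |c - d| := by
        rw [← abs_mul, ← abs_mul]; exact abs_add_le _ _
      _ ≤ |a - b| + b * |c - d| := by
        rw [abs_of_nonneg hb, abs_of_nonneg hc.1]
        gcongr
        exact mul_le_of_le_one_right (abs_nonneg _) hc.2

lemma add_rpow_le_two_rpow_mul {p a b : ℝ} (hp : 0 ≤ p) (ha : 0 ≤ a) (hb : 0 ≤ b) :
    (a + b) ^ p ≤ 2 ^ p * (a ^ p + b ^ p) := by
  have hap := Real.rpow_nonneg ha p
  have hbp := Real.rpow_nonneg hb p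
  rcases le_total a b with h | h
  · calc (a + b) ^ p ≤ (2 * b) ^ p := by gcongr; linarith
      _ = 2 ^ p * b ^ p := Real.mul_rpow (by norm_num) hb
      _ ≤ _ := by gcongr; linarith
  · calc (a + b) ^ p ≤ (2 * a) ^ p := by gcongr; linarith
      _ = 2 ^ p * a ^ p := Real.mul_rpow (by norm_num) ha
      _ ≤ _ := by gcongr; linarith

lemma exists_lipschitzWith_smoothTransition :
    ∃ K : ℝ≥0, LipschitzWith K Real.smoothTransition := by
  let b : ContDiffBump (0 : ℝ) := ⟨2, 3, by norm_num, by norm_num⟩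
  obtain ⟨K, hK⟩ := ContDiff.lipschitzWith_of_hasCompactSupport (𝕂 := ℝ)
    (f := fun t ↦ Real.smoothTransition t * b t) (n := 1)
    b.hasCompactSupport.mul_left (Real.smoothTransition.contDiff.mul b.contDiff) (by norm_num)
  have hmin : Real.smoothTransition
      = (fun t ↦ Real.smoothTransition t * b t) ∘ fun t ↦ min t 1 := by
    ext t
    simp only [Function.comp_apply]
    rcases le_total t 0 with h0 | h0
    · simp [min_eq_left (h0.trans zero_le_one), Real.smoothTransition.zero_of_nonpos h0]
    · have hb : b (min t 1) = 1 := b.one_of_mem_closedBall <| by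
        rw [mem_closedBall, Real.dist_eq, sub_zero, abs_of_nonneg (le_min h0 zero_le_one)]
        exact (min_le_right _ _).trans one_le_two
      rw [hb, mul_one]
      rcases le_total t 1 with h1 | h1
      · rw [min_eq_left h1]
      · rw [min_eq_right h1, Real.smoothTransition.one_of_one_le h1,
          Real.smoothTransition.one]
  refine ⟨K * 1, ?_⟩
  rw [hmin]
  exact hK.comp (LipschitzWith.id.min_const 1)

/-- The coordinates of the plane identify its measure with the product measure on `ℝ × ℝ`. -/
lemma measurePreserving_coords :
    MeasurePreserving (fun x : Euc 2 ↦ ((x 0, x 1) : ℝ × ℝ)) :=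
  (volume_preserving_finTwoArrow ℝ).comp (PiLp.volume_preserving_ofLp (Fin 2))

lemma infDist_frontier_upperHalfPlane {x : Euc 2} (hx : 0 < x 1) :
    infDist x (frontier {x : Euc 2 | 0 < x 1}) ∈ Ioc 0 (x 1) := by
  have hfr : frontier {x : Euc 2 | 0 < x 1} = {x : Euc 2 | x 1 = 0} := by
    have hsurj : Function.Surjective (EuclideanSpace.proj (𝕜 := ℝ) (1 : Fin 2)) := fun t ↦
      ⟨EuclideanSpace.single 1 t, by simp⟩
    have := (EuclideanSpace.proj (𝕜 := ℝ) (1 : Fin 2)).frontier_preimage hsurj (Ioi 0)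
    rw [frontier_Ioi] at this
    exact this
  rw [hfr]
  have hmem : !₂[x 0, 0] ∈ {x : Euc 2 | x 1 = 0} := by simp
  constructor
  · refine ((IsClosed.notMem_iff_infDist_pos ?_ ⟨_, hmem⟩).1 hx.ne')
    exact isClosed_eq (by fun_prop) continuous_const
  · refine (infDist_le_dist_of_mem hmem).trans_eq ?_
    simp [EuclideanSpace.dist_eq, Fin.sum_univ_two, Real.sqrt_sq_eq_abs, abs_of_pos hx]

lemma ofReal_log_le_lintegral {ε : ℝ} (hε : 0 < ε) (hε1 : ε ≤ 1) :
    ENNReal.ofReal (Real.log (1 / ε)) ≤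
      ∫⁻ x in {x : Euc 2 | x 0 ∈ Ioc 0 1 ∧ x 1 ∈ Ioc ε 1}, ENNReal.ofReal (1 / x 1) := by
  have h1 : ∫⁻ t in Ioc ε 1, ENNReal.ofReal (1 / t) = ENNReal.ofReal (Real.log (1 / ε)) := by
    have h0 : (0 : ℝ) ∉ uIcc ε 1 := by
      rw [uIcc_of_le hε1]; exact fun h ↦ hε.not_ge h.1
    rw [← integral_one_div h0, intervalIntegral.integral_of_le hε1,
      ofReal_integral_eq_lintegral_ofReal]
    · refine (intervalIntegrable_iff_integrableOn_Ioc_of_le hε1).1 ?_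
      exact intervalIntegral.intervalIntegrable_one_div
        (fun t ht h ↦ h0 (by simpa [h] using ht)) continuousOn_id
    · filter_upwards [ae_restrict_mem measurableSet_Ioc] with t ht
      exact one_div_nonneg.2 (hε.trans ht.1).le
  have h2 := measurePreserving_coords.setLIntegral_comp_preimage
    (s := Ioc 0 1 ×ˢ Ioc ε 1) (measurableSet_Ioc.prod measurableSet_Ioc)
    (f := fun q ↦ ENNReal.ofReal (1 / q.2)) (by fun_prop)
  refine le_of_eq (Eq.trans ?_ h2.symm)
  rw [Measure.volume_eq_prod, ← Measure.prod_restrict, lintegral_prod _ (by fun_prop)]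
  simp only [h1, lintegral_const, Measure.restrict_apply_univ, Real.volume_Ioc, sub_zero,
    ENNReal.ofReal_one, mul_one]

lemma volume_box {a b c d : ℝ} :
    volume {x : Euc 2 | x 0 ∈ Icc a b ∧ x 1 ∈ Ioo c d}
      = ENNReal.ofReal (b - a) * ENNReal.ofReal (d - c) := by
  have h := measurePreserving_coords.measure_preimage (s := Icc a b ×ˢ Ioo c d)
    (measurableSet_Icc.prod measurableSet_Ioo).nullMeasurableSet
  refine h.trans ?_
  rw [Measure.volume_eq_prod, Measure.prod_prod, Real.volume_Icc, Real.volume_Ioo]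

lemma abs_apply_le_norm (x : Euc 2) (i : Fin 2) : |x i| ≤ ‖x‖ := by
  simpa using PiLp.norm_apply_le x i

/-- The plateau at the origin of radius `2`. -/
def planeBump : ContDiffBump (0 : Euc 2) := ⟨2, 3, by norm_num, by norm_num⟩

/-- The plateau at the origin, cut off at height `ε` above the boundary of the half-plane. -/
def stripCutoff (ε : ℝ) (x : Euc 2) : ℝ :=
  planeBump x * Real.smoothTransition (x 1 / ε - 1)

lemma contDiff_stripCutoff (ε : ℝ) : ContDiff ℝ (⊤ : ℕ∞) (stripCutoff ε) := by
  unfold stripCutoff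
  refine planeBump.contDiff.mul (Real.smoothTransition.contDiff.comp ?_)
  fun_prop

lemma hasCompactSupport_stripCutoff (ε : ℝ) : HasCompactSupport (stripCutoff ε) :=
  planeBump.hasCompactSupport.mul_right

lemma tsupport_stripCutoff_subset {ε : ℝ} (hε : 0 < ε) :
    tsupport (stripCutoff ε) ⊆ {x | 0 < x 1} := by
  have h : tsupport (stripCutoff ε) ⊆ {x | ε ≤ x 1} := by
    refine closure_minimal (fun x hx ↦ ?_) (isClosed_le continuous_const (by fun_prop))
    by_contra hlt
    refine hx (mul_eq_zero_of_right _ (Real.smoothTransition.zero_of_nonpos ?_))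
    rw [sub_nonpos, div_le_one hε]
    exact (not_le.1 hlt).le
  exact h.trans fun x hx ↦ hε.trans_le hx

lemma stripCutoff_eq_one {ε : ℝ} (hε : 0 < ε) {x : Euc 2} (h0 : x 0 ∈ Ioc 0 1)
    (h1 : x 1 ∈ Ioc (2 * ε) 1) : stripCutoff ε x = 1 := by
  have hb : planeBump x = 1 := planeBump.one_of_mem_closedBall <| by
    rw [mem_closedBall, dist_zero_right, EuclideanSpace.norm_eq]
    refine Real.sqrt_le_iff.2 ⟨zero_le_two, ?_⟩
    have h1' : 0 < x 1 := by linarith [h1.1]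
    simp only [Fin.sum_univ_two, Real.norm_eq_abs, sq_abs]
    change _ ≤ (2 : ℝ) ^ 2
    nlinarith [h0.1, h0.2, h1.2]
  rw [stripCutoff, hb, one_mul, Real.smoothTransition.one_of_one_le]
  rw [le_sub_iff_add_le, le_div_iff₀ hε]
  linarith [h1.1]

/-- The part of the half-plane in which the cut-off at height `ε` varies. -/
def boundaryStrip (ε : ℝ) : Set (Euc 2) := {x | x 0 ∈ Icc (-3) 3 ∧ x 1 ∈ Ioo 0 (2 * ε)}

lemma measurableSet_boundaryStrip (ε : ℝ) : MeasurableSet (boundaryStrip ε) :=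
  measurePreserving_coords.measurable (measurableSet_Icc.prod measurableSet_Ioo)

lemma stripCutoff_energy_density_le {p : ℝ} (hp : 0 < p) {K M : ℝ≥0}
    (hK : LipschitzWith K planeBump) (hM : LipschitzWith M Real.smoothTransition)
    {ε : ℝ} (hε : 0 < ε) {x y : Euc 2} (hx : 0 < x 1) (hy : 0 < y 1) :
    ENNReal.ofReal (|stripCutoff ε x - stripCutoff ε y| ^ p / dist x y ^ (3 : ℝ)) ≤
      ENNReal.ofReal (2 ^ p) *
        (((closedBall 0 3).indicator 1 x + (closedBall 0 3).indicator 1 y) *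
            truncKernel p (K + 1) (x - y) +
          ((boundaryStrip ε).indicator 1 x + (boundaryStrip ε).indicator 1 y) *
            truncKernel p ((M + 1) / ε) (x - y)) := by
  set χ : Euc 2 → ℝ := fun x ↦ Real.smoothTransition (x 1 / ε - 1) with hχ
  have hχm (z : Euc 2) : χ z ∈ Icc (0 : ℝ) 1 :=
    ⟨Real.smoothTransition.nonneg _, Real.smoothTransition.le_one _⟩
  have hψ0 (z : Euc 2) : 0 ≤ planeBump z := planeBump.nonneg
  have hψ1 (z : Euc 2) : planeBump z ≤ 1 := planeBump.le_one
  have hψs {z : Euc 2} (hz : z ∉ closedBall 0 3) : planeBump z = 0 :=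
    planeBump.zero_of_le_dist (not_le.1 hz).le
  have hd : 0 ≤ dist x y := dist_nonneg
  set a := |planeBump x - planeBump y|
  set b := min (planeBump x) (planeBump y) * |χ x - χ y| with hb
  have ha0 : 0 ≤ a := abs_nonneg _
  have hb0 : 0 ≤ b := mul_nonneg (le_min (hψ0 x) (hψ0 y)) (abs_nonneg _)
  have hχ1 : |χ x - χ y| ≤ 1 := by
    rw [abs_le]; constructor <;> linarith [(hχm x).1, (hχm x).2, (hχm y).1, (hχm y).2]
  have hbχ : b ≤ |χ x - χ y| :=
    mul_le_of_le_one_left (abs_nonneg _) ((min_le_left _ _).trans (hψ1 x))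
  have hA := ofReal_rpow_div_dist_le (L := K + 1) (S := closedBall 0 3) hp ha0
    (by rw [abs_le]; constructor <;> linarith [hψ0 x, hψ0 y, hψ1 x, hψ1 y])
    (by
      have := hK.dist_le_mul x y
      rw [Real.dist_eq] at this
      linarith)
    (fun h1 h2 ↦ by simp [a, hψs h1, hψs h2])
  have hB := ofReal_rpow_div_dist_le (L := (M + 1) / ε) (S := boundaryStrip ε) hp hb0
    (hbχ.trans hχ1)
    (by
      refine hbχ.trans ?_
      have h1 := hM.dist_le_mul (x 1 / ε - 1) (y 1 / ε - 1)
      have h2 : dist (x 1 / ε - 1) (y 1 / ε - 1) ≤ dist x y / ε := by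
        rw [dist_sub_right, Real.dist_eq, ← sub_div, abs_div, abs_of_pos hε, dist_eq_norm]
        gcongr
        exact abs_apply_le_norm (x - y) 1
      rw [Real.dist_eq] at h1
      calc |χ x - χ y| ≤ M * (dist x y / ε) :=
            h1.trans (mul_le_mul_of_nonneg_left h2 M.coe_nonneg)
        _ ≤ (M + 1) * (dist x y / ε) := by gcongr; linarith
        _ = _ := by ring)
    (fun h1 h2 ↦ by
      have key {z : Euc 2} (hz : 0 < z 1) (h : z ∉ boundaryStrip ε)
          (hzb : planeBump z ≠ 0) : χ z = 1 := by
        have hzB : ‖z‖ ≤ 3 := by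
          by_contra hn
          exact hzb (hψs (by simpa using hn))
        have h0 : z 0 ∈ Icc (-3 : ℝ) 3 := abs_le.1 ((abs_apply_le_norm z 0).trans hzB)
        have h2ε : 2 * ε ≤ z 1 := by
          by_contra hn
          exact h ⟨h0, hz, not_le.1 hn⟩
        refine Real.smoothTransition.one_of_one_le ?_
        rw [le_sub_iff_add_le, le_div_iff₀ hε]
        linarith
      by_cases hx0 : planeBump x = 0
      · simp [hb, hx0, hψ0 y]
      by_cases hy0 : planeBump y = 0
      · simp [hb, hy0, hψ0 x]
      simp [hb, key hx h1 hx0, key hy h2 hy0])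
  refine le_trans ?_ (mul_le_mul_right (add_le_add hA hB) _)
  rw [← ENNReal.ofReal_add (by positivity) (by positivity),
    ← ENNReal.ofReal_mul (by positivity), ← add_div, ← mul_div_assoc]
  gcongr
  refine le_trans ?_ (add_rpow_le_two_rpow_mul hp.le ha0 hb0)
  gcongr
  exact abs_mul_sub_mul_le_add_min (hψ0 x) (hψ0 y) (hχm x) (hχm y)

/-- The energies of the cut-offs are bounded uniformly in the height of the cut-off. -/
lemma exists_energy_bound {p : ℝ} (hp : 1 < p) :
    ∃ C : ℝ≥0∞, C < ∞ ∧ ∀ ε : ℝ, 0 < ε →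
      ∫⁻ x in {x : Euc 2 | 0 < x 1}, ∫⁻ y in {x : Euc 2 | 0 < x 1},
        ENNReal.ofReal (|stripCutoff ε x - stripCutoff ε y| ^ p / dist x y ^ (3 : ℝ)) ≤ C := by
  have hp0 : 0 < p := by linarith
  obtain ⟨K, hK⟩ := ContDiff.lipschitzWith_of_hasCompactSupport (𝕂 := ℝ) (n := 1)
    planeBump.hasCompactSupport planeBump.contDiff (by norm_num)
  obtain ⟨M, hM⟩ := exists_lipschitzWith_smoothTransition
  have hH : MeasurableSet {x : Euc 2 | 0 < x 1} := measurableSet_lt (by fun_prop) (by fun_prop)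
  set J := ∫⁻ z, truncKernel p 1 z
  have hJ : J < ∞ := lintegral_truncKernel_one_lt_top hp
  have hball : volume (closedBall (0 : Euc 2) 3) < ∞ := measure_closedBall_lt_top
  refine ⟨ENNReal.ofReal (2 ^ p) *
    (2 * (volume (closedBall (0 : Euc 2) 3) * (ENNReal.ofReal (K + 1) * J)) +
      2 * (ENNReal.ofReal (12 * (M + 1)) * J)), ?_, fun ε hε ↦ ?_⟩
  · finiteness
  have hstrip : volume (boundaryStrip ε) * (ENNReal.ofReal ((M + 1) / ε) * J)
      = ENNReal.ofReal (12 * (M + 1)) * J := by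
    rw [boundaryStrip, volume_box, ← mul_assoc, ← ENNReal.ofReal_mul (by norm_num),
      ← ENNReal.ofReal_mul (by linarith)]
    congr 2
    field_simp
    ring
  rw [← hstrip, ← lintegral_truncKernel (by positivity), ← lintegral_truncKernel (by positivity),
    ← lintegral_lintegral_indicator_add_mul_sub measurableSet_closedBall (by fun_prop),
    ← lintegral_lintegral_indicator_add_mul_sub (measurableSet_boundaryStrip ε) (by fun_prop)]
  have hI1 : Measurable ((closedBall (0 : Euc 2) 3).indicator (1 : Euc 2 → ℝ≥0∞)) :=
    measurable_one.indicator measurableSet_closedBall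
  have hI2 : Measurable ((boundaryStrip ε).indicator (1 : Euc 2 → ℝ≥0∞)) :=
    measurable_one.indicator (measurableSet_boundaryStrip ε)
  rw [← lintegral_add_left (Measurable.lintegral_prod_right' (f := fun q : Euc 2 × Euc 2 ↦
      ((closedBall 0 3).indicator 1 q.1 + (closedBall 0 3).indicator 1 q.2) *
        truncKernel p (K + 1) (q.1 - q.2)) (by fun_prop)),
    ← lintegral_const_mul' _ _ ENNReal.ofReal_ne_top]
  refine (setLIntegral_mono' hH fun x hx ↦ ?_).trans (setLIntegral_le_lintegral _ _)
  rw [← lintegral_add_left (by fun_prop), ← lintegral_const_mul' _ _ ENNReal.ofReal_ne_top]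
  exact (setLIntegral_mono' hH fun y hy ↦
    stripCutoff_energy_density_le hp0 hK hM hε hx hy).trans (setLIntegral_le_lintegral _ _)

lemma ofReal_log_le_lintegral_stripCutoff {p ε : ℝ} (hε : 0 < ε) (hε1 : 2 * ε ≤ 1) :
    ENNReal.ofReal (Real.log (1 / (2 * ε))) ≤ ∫⁻ x in {x : Euc 2 | 0 < x 1},
      ENNReal.ofReal (|stripCutoff ε x| ^ p /
        infDist x (frontier {x : Euc 2 | 0 < x 1}) ^ (1 : ℝ)) := by
  have hm : MeasurableSet {x : Euc 2 | x 0 ∈ Ioc 0 1 ∧ x 1 ∈ Ioc (2 * ε) 1} :=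
    measurePreserving_coords.measurable (measurableSet_Ioc.prod measurableSet_Ioc)
  have hpos {x : Euc 2} (hx : x 1 ∈ Ioc (2 * ε) 1) : 0 < x 1 := by linarith [hx.1]
  refine (ofReal_log_le_lintegral (by linarith) hε1).trans
    ((setLIntegral_mono' hm fun x hx ↦ ?_).trans
      (lintegral_mono_set fun x hx ↦ hpos hx.2))
  obtain ⟨h0, h1⟩ := infDist_frontier_upperHalfPlane (hpos hx.2)
  rw [stripCutoff_eq_one hε hx.1 hx.2, abs_one, Real.one_rpow, Real.rpow_one]
  gcongr

/-- For `1<p<∞`, `0<s<1` with `sp = 1`, the open upper half-plane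
`H = {x ∈ ℝ² : x₂ > 0}` does not admit the `(s,p)`-Hardy inequality. -/
theorem statement14 (s p : ℝ) (hp1 : 1 < p) (hs0 : 0 < s) (hs1 : s < 1)
    (hsp : s * p = 1) :
    ¬ AdmitsHardy 2 s p {x : Euc 2 | 0 < x 1} := by
  rintro ⟨c, -, hc⟩
  obtain ⟨C, hC, hE⟩ := exists_energy_bound hp1
  have hexp : ((2 : ℕ) : ℝ) + 1 = 3 := by norm_num
  have hle (ε : ℝ) (hε : 0 < ε) (hε1 : 2 * ε ≤ 1) :
      ENNReal.ofReal (Real.log (1 / (2 * ε))) ≤ ENNReal.ofReal c * C := by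
    have h := hc (stripCutoff ε) (contDiff_stripCutoff ε) (hasCompactSupport_stripCutoff ε)
      (tsupport_stripCutoff_subset hε)
    rw [hsp, hexp] at h
    exact (ofReal_log_le_lintegral_stripCutoff hε hε1).trans
      (h.trans (mul_le_mul_right (hE ε hε) _))
  have hfin : ENNReal.ofReal c * C ≠ ∞ := by finiteness
  set T := (ENNReal.ofReal c * C).toReal
  have hT : 0 ≤ T := ENNReal.toReal_nonneg
  have h := hle (Real.exp (-(T + 1)) / 2) (by positivity) (by
    rw [mul_div_cancel₀ _ two_ne_zero]
    exact Real.exp_le_one_iff.2 (by linarith))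
  rw [mul_div_cancel₀ _ two_ne_zero, one_div, ← Real.exp_neg, neg_neg, Real.log_exp,
    ENNReal.ofReal_le_iff_le_toReal hfin] at h
  linarith

end
end
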